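/- arXiv:2409.03026 — 4 statements merged into one kernel-verified Lean document; each statement's English description precedes it below -/
import Mathlib

section
/- Let k ≥ 1 and let (A_1, …, A_k) be a KKM cover of the standard simplex Δ^{k−1} by closed sets. Then ⋂_{i=1}^k A_i ≠ ∅. -/
open Finset

section Scarf

variable {V T ι L : Type*} [LinearOrder L]

/-- A set `S` is dominant for the utilities `u` if no alternative is strictly better, for every
utility simultaneously, than the worst element of `S`. -/
def IsDominant (u : ι → V → L) (S : Finset V) : Prop :=
  ∀ y, ∃ i, ∀ x ∈ S, u i y ≤ u i x

theorem IsDominant.mono {u : ι → V → L} {S R : Finset V} (hR : IsDominant u R) (h : S ⊆ R) :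
    IsDominant u S := fun y =>
  (hR y).imp fun _ hi x hx => hi x (h hx)

theorem even_card_filter_erase_of_image_ne_univ [DecidableEq V] [Fintype ι] [DecidableEq ι]
    (c : V → ι) (i₀ : ι) {R : Finset V} (hcard : #R = Fintype.card ι)
    (hR : R.image c ≠ univ) :
    Even #{x ∈ R | (R.erase x).image c = univ.erase i₀} := by
  obtain h | ⟨x₀, hx₀⟩ := ({x ∈ R | (R.erase x).image c = univ.erase i₀}).eq_empty_or_nonempty
  · simp [h]
  obtain ⟨hx₀R, himg⟩ := mem_filter.1 hx₀
  have hinj : Set.InjOn c (R.erase x₀) := by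
    rw [← card_image_iff, himg, card_erase_of_mem hx₀R, card_erase_of_mem (mem_univ _), hcard,
      card_univ]
  have hne : c x₀ ≠ i₀ := by
    rintro rfl
    apply hR
    rw [← insert_erase hx₀R, image_insert, himg, insert_erase (mem_univ _)]
  obtain ⟨x₁, hx₁, hc⟩ : ∃ x₁ ∈ R.erase x₀, c x₁ = c x₀ := by
    rw [← mem_image, himg]
    simpa using hne
  obtain ⟨hx₁₀, hx₁R⟩ := mem_erase.1 hx₁
  have : ({x ∈ R | (R.erase x).image c = univ.erase i₀}) = {x₀, x₁} := by
    ext x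
    simp only [mem_filter, mem_insert, mem_singleton]
    constructor
    · rintro ⟨hxR, hx⟩
      by_contra! hcon
      have hmem : c x ∈ (R.erase x).image c := by
        rw [hx, ← himg]
        exact mem_image_of_mem c (mem_erase.2 ⟨hcon.1, hxR⟩)
      obtain ⟨z, hz, hzx⟩ := mem_image.1 hmem
      obtain ⟨hz1, hzR⟩ := mem_erase.1 hz
      by_cases hz0 : z = x₀
      · subst hz0
        exact hcon.2 (hinj (by simp [hcon.1, hxR]) (mem_coe.2 hx₁) (by rw [hc, hzx]))
      · exact hz1 (hinj (by simp [hz0, hzR]) (by simp [hcon.1, hxR]) hzx)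
    · rintro (rfl | rfl)
      · exact ⟨hx₀R, himg⟩
      · refine ⟨hx₁R, ?_⟩
        rw [← himg, ← insert_erase (mem_erase.2 ⟨hx₁₀.symm, hx₀R⟩),
          ← insert_erase hx₁, image_insert, image_insert, hc, erase_right_comm]
  rw [this, card_pair hx₁₀.symm]
  exact even_two

/-- The extensions of a dominant set of size `|ι| - 1` to a dominant set of size `|ι|`: one for each
of the two utilities sharing their worst element, as long as that utility has a candidate. -/
theorem IsDominant.exists_extensions [Fintype V] [DecidableEq V] [Fintype ι]
    {u : ι → V → L} (hu : ∀ i, Function.Injective (u i)) {S : Finset V} (hS : IsDominant u S)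
    (hne : S.Nonempty) (hcard : #S + 1 = Fintype.card ι) :
    ∃ (m : ι → V) (i j : ι), (∀ k, m k ∈ S) ∧ (∀ k, ∀ x ∈ S, u k (m k) ≤ u k x) ∧ i ≠ j ∧
      m i = m j ∧ ∀ v, (v ∉ S ∧ IsDominant u (insert v S)) ↔
        ∃ p, (p = i ∨ p = j) ∧ u p v ≤ u p (m p) ∧ (∀ k ≠ p, u k (m k) < u k v) ∧
          ∀ z, (∀ k ≠ p, u k (m k) < u k z) → u p z ≤ u p v := by
  classical
  choose m hmS hm using fun k => S.exists_min_image (u k) hne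
  obtain ⟨i, -, j, -, hij, hmij⟩ := exists_ne_map_eq_of_card_lt_of_maps_to
    (s := (univ : Finset ι)) (t := S) (f := m) (by rw [card_univ]; omega) (fun k _ => hmS k)
  refine ⟨m, i, j, hmS, hm, hij, hmij, fun v => ⟨?_, ?_⟩⟩
  · rintro ⟨hvS, hv⟩
    obtain ⟨p, hp⟩ := hv v
    have hpm := hp _ (mem_insert_of_mem (hmS p))
    have hsub : S ⊆ ({k | u k (m k) < u k v} : Finset ι).image m := by
      intro x hx
      obtain ⟨k, hk⟩ := hv x
      have hmk : m k = x :=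
        hu k (le_antisymm (hm k x hx) (hk _ (mem_insert_of_mem (hmS k))))
      refine mem_image.2 ⟨k, ?_, hmk⟩
      simp only [mem_filter, mem_univ, true_and, hmk]
      refine lt_of_le_of_ne (hk v (mem_insert_self _ _)) fun h => hvS ?_
      rwa [← hu k h]
    have key : ∀ k ≠ p, ¬ S ⊆ ((univ.erase p).erase k).image m := by
      intro k hk h
      have h1 := (card_le_card h).trans card_image_le
      rw [card_erase_of_mem (mem_erase.2 ⟨hk, mem_univ _⟩), card_erase_of_mem (mem_univ _),
        card_univ] at h1
      have : 0 < #S := hne.card_pos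
      omega
    have hlt : ∀ k ≠ p, u k (m k) < u k v := by
      intro k hk
      by_contra hkv
      refine key k hk (hsub.trans (image_subset_image fun l hl => ?_))
      simp only [mem_filter, mem_univ, true_and] at hl
      simp only [mem_erase, mem_univ, and_true]
      refine ⟨?_, ?_⟩
      · rintro rfl; exact hkv hl
      · rintro rfl; exact hpm.not_gt hl
    refine ⟨p, ?_, hpm, hlt, fun z hz => ?_⟩
    · by_contra! hpij
      refine key i hpij.1.symm (hsub.trans fun x hx => ?_)
      obtain ⟨l, hl, rfl⟩ := mem_image.1 hx
      simp only [mem_filter, mem_univ, true_and] at hl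
      have hlp : l ≠ p := by rintro rfl; exact hpm.not_gt hl
      by_cases hli : l = i
      · exact mem_image.2 ⟨j, by simp [hij.symm, hpij.2.symm], by rw [hli, hmij]⟩
      · exact mem_image_of_mem m (by simp [hli, hlp])
    · obtain ⟨k, hk⟩ := hv z
      by_cases hkp : k = p
      · subst hkp; exact hk v (mem_insert_self _ _)
      · exact absurd (hk _ (mem_insert_of_mem (hmS k))) (hz k hkp).not_ge
  · rintro ⟨p, hp, hpm, hlt, hmax⟩
    obtain ⟨q, hqp, hmq⟩ : ∃ q ≠ p, m q = m p := by
      rcases hp with rfl | rfl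
      · exact ⟨j, hij.symm, hmij.symm⟩
      · exact ⟨i, hij, hmij⟩
    refine ⟨fun hvS => ?_, fun y => ?_⟩
    · obtain ⟨k, hk⟩ := hS v
      have hmk : m k = v := hu k (le_antisymm (hm k v hvS) (hk _ (hmS k)))
      by_cases hkp : k = p
      · subst hkp
        have := hlt q hqp
        rw [hmq, hmk] at this
        exact this.false
      · have := hlt k hkp
        rw [hmk] at this
        exact this.false
    · by_cases hy : ∀ k ≠ p, u k (m k) < u k y
      · refine ⟨p, fun x hx => ?_⟩
        rcases mem_insert.1 hx with rfl | hx
        · exact hmax y hy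
        · exact (hmax y hy).trans (hpm.trans (hm p x hx))
      · push Not at hy
        obtain ⟨k, hkp, hk⟩ := hy
        refine ⟨k, fun x hx => ?_⟩
        rcases mem_insert.1 hx with rfl | hx
        · exact hk.trans (hlt k hkp).le
        · exact hk.trans (hm k x hx)

variable [Fintype T] [DecidableEq T] [Fintype ι] [DecidableEq ι] {u : ι → T ⊕ ι → L}

open Classical in
theorem card_extensions_eq_two (hu : ∀ i, Function.Injective (u i))
    (htop : ∀ i j t, i ≠ j → u i (.inl t) < u i (.inr j))
    {S : Finset (T ⊕ ι)} (hS : IsDominant u S) {t : T} (ht : .inl t ∈ S)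
    (hcard : #S + 1 = Fintype.card ι) :
    #{v | v ∉ S ∧ IsDominant u (insert v S)} = 2 := by
  obtain ⟨m, i, j, hmS, hm, hij, hmij, hext⟩ := hS.exists_extensions hu ⟨_, ht⟩ hcard
  have hex : ∀ p q, p ≠ q → m p = m q → ∃ v, u p v ≤ u p (m p) ∧ (∀ k ≠ p, u k (m k) < u k v) ∧
      ∀ z, (∀ k ≠ p, u k (m k) < u k z) → u p z ≤ u p v := by
    intro p q hpq hmpq
    have hne : ({v | ∀ k ≠ p, u k (m k) < u k v} : Finset (T ⊕ ι)).Nonempty := by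
      refine ⟨.inr p, ?_⟩
      simp only [mem_filter, mem_univ, true_and]
      exact fun k hk => (hm k _ ht).trans_lt (htop k p t hk)
    obtain ⟨v, hv, hmax⟩ := exists_max_image _ (u p) hne
    simp only [mem_filter, mem_univ, true_and] at hv hmax
    refine ⟨v, ?_, hv, hmax⟩
    obtain ⟨k, hk⟩ := hS v
    by_cases hkp : k = p
    · subst hkp; exact hk _ (hmS k)
    · exact absurd (hk _ (hmS k)) (hv k hkp).not_ge
  obtain ⟨v, hv, hv', hvmax⟩ := hex i j hij hmij
  obtain ⟨w, hw, hw', hwmax⟩ := hex j i hij.symm hmij.symm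
  have hvw : v ≠ w := by
    rintro rfl
    exact (hv' j hij.symm).not_ge hw
  rw [← card_pair hvw]
  congr 1
  ext x
  simp only [mem_filter, mem_univ, true_and, hext, mem_insert, mem_singleton]
  constructor
  · rintro ⟨p, rfl | rfl, hx, hx', hxmax⟩
    · exact .inl (hu _ (le_antisymm (hvmax x hx') (hxmax v hv')))
    · exact .inr (hu _ (le_antisymm (hwmax x hx') (hxmax w hw')))
  · rintro (rfl | rfl)
    · exact ⟨i, .inl rfl, hv, hv', hvmax⟩
    · exact ⟨j, .inr rfl, hw, hw', hwmax⟩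

open Classical in
theorem card_extensions_eq_one [Nonempty T] (hu : ∀ i, Function.Injective (u i))
    (hbot : ∀ i v, u i (.inr i) ≤ u i v) (htop : ∀ i j t, i ≠ j → u i (.inl t) < u i (.inr j))
    (i₀ : ι) :
    #{v | v ∉ (univ.erase i₀).image (Sum.inr : ι → T ⊕ ι) ∧
      IsDominant u (insert v ((univ.erase i₀).image Sum.inr))} = 1 := by
  have hlt : ∀ i t, ¬ u i (.inl t) ≤ u i (.inr i) := fun i t h =>
    Sum.inl_ne_inr (hu i (le_antisymm h (hbot i _)))
  obtain ⟨t₀, -, ht₀⟩ := exists_max_image (univ : Finset T) (fun t => u i₀ (.inl t)) univ_nonempty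
  rw [card_eq_one]
  refine ⟨.inl t₀, ?_⟩
  ext v
  simp only [mem_filter, mem_univ, true_and, mem_singleton]
  constructor
  · rintro ⟨hv, hdom⟩
    obtain ⟨i, hi⟩ := hdom (.inl t₀)
    have hii : i = i₀ := by
      by_contra hii
      exact hlt i t₀ (hi _ (mem_insert_of_mem (mem_image_of_mem _ (by simpa using hii))))
    subst hii
    have hle := hi v (mem_insert_self _ _)
    rcases v with t | j
    · exact hu i (le_antisymm (ht₀ t (mem_univ _)) hle)
    · have : j = i := by
        by_contra hji
        exact hv (mem_image_of_mem _ (by simpa using hji))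
      subst this
      exact absurd hle (hlt j t₀)
  · rintro rfl
    refine ⟨by simp, fun y => ?_⟩
    rcases y with t | j
    · refine ⟨i₀, fun x hx => ?_⟩
      rcases mem_insert.1 hx with rfl | hx
      · exact ht₀ t (mem_univ _)
      · obtain ⟨k, hk, rfl⟩ := mem_image.1 hx
        exact (htop i₀ k t (ne_of_mem_erase hk).symm).le
    · exact ⟨j, fun x _ => hbot j x⟩

/-- The parity argument: some dominant set of size `|ι|` carries all the colours. -/
theorem exists_isDominant_image_eq_univ [Nonempty T] [Nonempty ι]
    (hu : ∀ i, Function.Injective (u i))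
    (hbot : ∀ i v, u i (.inr i) ≤ u i v) (htop : ∀ i j t, i ≠ j → u i (.inl t) < u i (.inr j))
    (c : T → ι) :
    ∃ R : Finset (T ⊕ ι), IsDominant u R ∧ R.image (Sum.elim c id) = univ := by
  classical
  by_contra! hcon
  obtain ⟨i₀⟩ := ‹Nonempty ι›
  set c' : T ⊕ ι → ι := Sum.elim c id
  let rooms : Finset (Finset (T ⊕ ι)) := {R | IsDominant u R ∧ #R = Fintype.card ι}
  let doors : Finset (Finset (T ⊕ ι)) :=
    {S | S.image c' = univ.erase i₀ ∧ #S + 1 = Fintype.card ι}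
  have hcount := sum_card_bipartiteAbove_eq_sum_card_bipartiteBelow (s := doors) (t := rooms)
    (fun S R => S ⊆ R)
  have hrooms : Even (∑ R ∈ rooms, #(doors.bipartiteBelow (fun S R => S ⊆ R) R)) := by
    refine even_sum _ fun R hR => ?_
    obtain ⟨hdom, hcard⟩ := (mem_filter.1 hR).2
    have heven := even_card_filter_erase_of_image_ne_univ c' i₀ hcard (hcon R hdom)
    suffices h : #{x ∈ R | (R.erase x).image c' = univ.erase i₀} =
        #(doors.bipartiteBelow (fun S R => S ⊆ R) R) from h ▸ heven
    refine card_bij (fun x _ => R.erase x) ?_ ?_ ?_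
    · intro x hx
      obtain ⟨hxR, hx⟩ := mem_filter.1 hx
      simp only [bipartiteBelow, doors, mem_filter, mem_univ, true_and]
      exact ⟨⟨hx, by rw [card_erase_add_one hxR, hcard]⟩, erase_subset _ _⟩
    · intro x hx y hy h
      exact (erase_inj R (mem_filter.1 hx).1).1 h
    · intro S hS
      simp only [bipartiteBelow, doors, mem_filter, mem_univ, true_and] at hS
      obtain ⟨⟨himg, hSc⟩, hSR⟩ := hS
      obtain ⟨x, hxS, rfl⟩ := exists_eq_insert_iff.2 ⟨hSR, hSc.trans hcard.symm⟩
      exact ⟨x, by simp [erase_insert hxS, himg], erase_insert hxS⟩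
  have hdoors : Odd (∑ S ∈ doors, #(rooms.bipartiteAbove (fun S R => S ⊆ R) S)) := by
    have hext : ∀ S ∈ doors, #(rooms.bipartiteAbove (fun S R => S ⊆ R) S) =
        #{v | v ∉ S ∧ IsDominant u (insert v S)} := by
      intro S hS
      obtain ⟨-, hSc⟩ := (mem_filter.1 hS).2
      symm
      refine card_bij (fun v _ => insert v S) ?_ ?_ ?_
      · intro v hv
        obtain ⟨hvS, hv⟩ := (mem_filter.1 hv).2
        simp only [bipartiteAbove, rooms, mem_filter, mem_univ, true_and]
        exact ⟨⟨hv, by rw [card_insert_of_notMem hvS, hSc]⟩, subset_insert _ _⟩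
      · intro v hv w _ h
        exact (insert_inj (mem_filter.1 hv).2.1).1 h
      · intro R hR
        simp only [bipartiteAbove, rooms, mem_filter, mem_univ, true_and] at hR
        obtain ⟨⟨hdom, hcard⟩, hSR⟩ := hR
        obtain ⟨x, hxS, rfl⟩ := exists_eq_insert_iff.2 ⟨hSR, hSc.trans hcard.symm⟩
        exact ⟨x, by simp [hxS, hdom], rfl⟩
    rw [sum_congr rfl hext]
    have hmem : (univ.erase i₀).image Sum.inr ∈ doors := by
      simp only [doors, mem_filter, mem_univ, true_and]
      refine ⟨by simp [image_image, c', Function.comp_def], ?_⟩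
      rw [card_image_of_injective _ Sum.inr_injective, card_erase_add_one (mem_univ _), card_univ]
    rw [← add_sum_erase _ _ hmem, card_extensions_eq_one hu hbot htop i₀]
    refine odd_one.add_even (even_sum _ fun S hS => ?_)
    obtain ⟨hne, hS⟩ := mem_erase.1 hS
    obtain ⟨himg, hSc⟩ := (mem_filter.1 hS).2
    by_cases hdom : IsDominant u S
    · have : ∃ t, Sum.inl t ∈ S := by
        by_contra! hinl
        apply hne
        rw [← himg, image_image]
        ext (t | j)
        · simp [hinl t]
        · simp only [mem_image, Function.comp_apply, Sum.inr.injEq]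
          constructor
          · exact fun hj => ⟨_, hj, rfl⟩
          · rintro ⟨t | k, hx, rfl⟩
            · exact absurd hx (hinl t)
            · exact hx
      obtain ⟨t, ht⟩ := this
      rw [card_extensions_eq_two hu htop hdom ht hSc]
      exact even_two
    · rw [filter_false_of_mem fun v _ h => hdom (h.2.mono (subset_insert _ _))]
      simp
  rw [hcount] at hdoors
  exact Nat.not_even_iff_odd.2 hdoors hrooms

/-- **Scarf's lemma** for a finite family of points with colours. -/
theorem exists_dominant_colored [Nonempty T] [Nonempty ι] (p : T → ι → ℝ) (c : T → ι) :
    ∃ σ : Finset T, σ.Nonempty ∧ ∀ t, ∃ i ∈ σ.image c, ∀ x ∈ σ, p t i ≤ p x i := by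
  let e := Fintype.equivFin T
  let e' := Fintype.equivFin ι
  let u : ι → T ⊕ ι → ℕ ×ₗ ℝ ×ₗ ℕ := fun i => Sum.elim
    (fun t => toLex (1, toLex (p t i, (e t : ℕ))))
    (fun j => if i = j then toLex (0, toLex (0, 0)) else toLex (2, toLex (0, (e' j : ℕ))))
  have hu : ∀ i, Function.Injective (u i) := by
    rintro i (t | j) (t' | j') h
    · simp only [u, Sum.elim_inl, EmbeddingLike.apply_eq_iff_eq, Prod.mk.injEq] at h
      exact congrArg _ (e.injective (Fin.ext h.2.2))
    · simp only [u, Sum.elim_inl, Sum.elim_inr] at h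
      split_ifs at h <;> simp at h
    · simp only [u, Sum.elim_inl, Sum.elim_inr] at h
      split_ifs at h <;> simp at h
    · simp only [u, Sum.elim_inr] at h
      split_ifs at h with h1 h2 h2
      · rw [← h1, h2]
      · simp at h
      · simp at h
      · simp only [EmbeddingLike.apply_eq_iff_eq, Prod.mk.injEq] at h
        exact congrArg _ (e'.injective (Fin.ext h.2.2))
  have hbot : ∀ i v, u i (.inr i) ≤ u i v := by
    rintro i (t | j)
    · simp [u, Prod.Lex.toLex_le_toLex]
    · by_cases hij : i = j
      · rw [hij]
      · simp [u, hij, Prod.Lex.toLex_le_toLex]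
  have htop : ∀ i j t, i ≠ j → u i (.inl t) < u i (.inr j) := by
    intro i j t hij
    simp [u, hij, Prod.Lex.toLex_lt_toLex]
  obtain ⟨R, hR, himg⟩ := exists_isDominant_image_eq_univ hu hbot htop c
  have hlt : ∀ i t, Sum.inr i ∈ R → ¬ ∀ x ∈ R, u i (.inl t) ≤ u i x := fun i t hi h =>
    Sum.inl_ne_inr (hu i (le_antisymm (h _ hi) (hbot i _)))
  have hcol : ∀ t, ∃ i ∈ R.toLeft.image c, ∀ x ∈ R.toLeft, p t i ≤ p x i := by
    intro t
    obtain ⟨i, hi⟩ := hR (.inl t)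
    refine ⟨i, ?_, fun x hx => ?_⟩
    · have : i ∈ R.image (Sum.elim c id) := himg ▸ mem_univ i
      obtain ⟨t' | j, hx, rfl⟩ := mem_image.1 this
      · exact mem_image_of_mem c (mem_toLeft.2 hx)
      · exact absurd hi (hlt j t hx)
    · have := hi _ (mem_toLeft.1 hx)
      simp only [u, Sum.elim_inl, Prod.Lex.toLex_le_toLex, lt_self_iff_false, true_and,
        false_or] at this
      exact this.elim le_of_lt fun h => h.1.le
  refine ⟨R.toLeft, ?_, hcol⟩
  obtain ⟨i, hi, -⟩ := hcol (Classical.arbitrary T)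
  exact image_nonempty.1 ⟨i, hi⟩

end Scarf

section Simplex

variable {ι : Type*} [Fintype ι]

theorem exists_mem_stdSimplex_near [Nonempty ι] (B : ι → Set (ι → ℝ))
    (hcover : ∀ x ∈ stdSimplex ℝ ι, ∃ i, x ∈ B i) {δ : ℝ} (hδ : 0 < δ) :
    ∃ x ∈ stdSimplex ℝ ι, ∀ i, x i ≤ δ ∨ ∃ y ∈ B i, dist x y ≤ δ := by
  classical
  have hn : (0 : ℝ) < Fintype.card ι := by exact_mod_cast Fintype.card_pos
  obtain ⟨N, hNsub, hNfin, hN⟩ := (isCompact_stdSimplex ℝ ι).finite_cover_balls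
    (div_pos hδ hn)
  have := hNfin.fintype
  have hnet : ∀ y ∈ stdSimplex ℝ ι, ∃ t : N, dist y t < δ / Fintype.card ι := by
    intro y hy
    obtain ⟨t, ht, hyt⟩ := Set.mem_iUnion₂.1 (hN hy)
    exact ⟨⟨t, ht⟩, hyt⟩
  have : Nonempty N :=
    (hnet _ (single_mem_stdSimplex ℝ (Classical.arbitrary ι))).nonempty
  choose c hc using fun t : N => hcover t (hNsub t.2)
  obtain ⟨σ, hσ, hdom⟩ := exists_dominant_colored (fun t : N => (t : ι → ℝ)) c
  set C := σ.image c with hC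
  have hCne : C.Nonempty := hσ.image c
  have hCpos : (0 : ℝ) < #C := by exact_mod_cast hCne.card_pos
  choose w hwσ hw using fun i : ι => σ.exists_min_image (fun t : N => (t : ι → ℝ) i) hσ
  have hsimp : ∀ t : N, (∀ i, 0 ≤ (t : ι → ℝ) i) ∧ ∑ i, (t : ι → ℝ) i = 1 := fun t => hNsub t.2
  let m : ι → ℝ := fun i => if i ∈ C then (w i : ι → ℝ) i else 0
  have hm0 : ∀ i, 0 ≤ m i := by
    intro i
    simp only [m]
    split_ifs
    exacts [(hsimp _).1 i, le_rfl]
  have hm : ∀ t ∈ σ, ∀ i, m i ≤ (t : ι → ℝ) i := by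
    intro t ht i
    simp only [m]
    split_ifs
    exacts [hw i t ht, (hsimp _).1 i]
  obtain ⟨x, hx⟩ := hσ
  have hsum : ∑ i, m i ≤ 1 := (hsimp x).2 ▸ sum_le_sum fun i _ => hm x hx i
  have hgap : 1 - ∑ i, m i ≤ δ := by
    let y : ι → ℝ := fun i => m i + if i ∈ C then (1 - ∑ i, m i) / #C else 0
    have hy : y ∈ stdSimplex ℝ ι := by
      refine ⟨fun i => add_nonneg (hm0 i) ?_, ?_⟩
      · split_ifs
        exacts [div_nonneg (sub_nonneg.2 hsum) hCpos.le, le_rfl]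
      · simp only [y, sum_add_distrib, sum_ite_mem, univ_inter, sum_const, nsmul_eq_mul]
        field_simp
        ring
    obtain ⟨t, ht⟩ := hnet y hy
    obtain ⟨i, hi, hti⟩ := hdom t
    have h1 := (dist_le_pi_dist y t i).trans ht.le
    rw [Real.dist_eq] at h1
    have h2 := (le_abs_self _).trans h1
    have h3 := hti _ (hwσ i)
    simp only [y, m, if_pos hi] at h2
    have h4 : (1 - ∑ i, m i) / #C ≤ δ / Fintype.card ι := by
      simp only [m]
      linarith
    rw [div_le_div_iff₀ hCpos hn] at h4
    have h5 : (#C : ℝ) ≤ Fintype.card ι := by exact_mod_cast card_le_univ C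
    nlinarith [mul_le_mul_of_nonneg_left h5 hδ.le]
  have hclose : ∀ t ∈ σ, ∀ i, (t : ι → ℝ) i ≤ m i + δ := by
    intro t ht i
    have h1 : (t : ι → ℝ) i - m i ≤ ∑ j, ((t : ι → ℝ) j - m j) :=
      single_le_sum (f := fun j => (t : ι → ℝ) j - m j)
        (fun j _ => sub_nonneg.2 (hm t ht j)) (mem_univ i)
    rw [sum_sub_distrib, (hsimp t).2] at h1
    linarith
  refine ⟨x, hNsub x.2, fun i => ?_⟩
  by_cases hi : i ∈ C
  · obtain ⟨t, ht, rfl⟩ := mem_image.1 hi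
    refine .inr ⟨t, hc t, (dist_pi_le_iff hδ.le).2 fun j => ?_⟩
    rw [Real.dist_eq, abs_le]
    have := hclose x hx j
    have := hclose t ht j
    have := hm x hx j
    have := hm t ht j
    constructor <;> linarith
  · left
    have := hclose x hx i
    simpa [m, hi] using this

/-- The dual form of the KKM theorem: each set contains the facet opposite to its vertex. -/
theorem exists_mem_forall_of_facet_subset [Nonempty ι] {B : ι → Set (ι → ℝ)}
    (hclosed : ∀ i, IsClosed (B i)) (hcover : ∀ x ∈ stdSimplex ℝ ι, ∃ i, x ∈ B i)
    (hfacet : ∀ i, ∀ x ∈ stdSimplex ℝ ι, x i = 0 → x ∈ B i) :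
    ∃ x ∈ stdSimplex ℝ ι, ∀ i, x ∈ B i := by
  classical
  have hne : ∀ i, (B i).Nonempty := by
    intro i
    obtain ⟨j, hj⟩ := hcover _ (single_mem_stdSimplex ℝ i)
    by_cases hij : i = j
    · subst hij
      exact ⟨_, hj⟩
    · exact ⟨_, hfacet i _ (single_mem_stdSimplex ℝ j) (Pi.single_eq_of_ne hij _)⟩
  let h : (ι → ℝ) → ℝ := fun x => ∑ i, min (Metric.infDist x (B i)) (x i)
  have hcont : Continuous h := by
    refine continuous_finsetSum _ fun i _ => ?_
    exact (Metric.continuous_infDist_pt _).min (continuous_apply i)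
  obtain ⟨x, hx, hmin⟩ := (isCompact_stdSimplex ℝ ι).exists_isMinOn
    ⟨_, single_mem_stdSimplex ℝ (Classical.arbitrary ι)⟩ hcont.continuousOn
  have hterm : ∀ i ∈ univ, 0 ≤ min (Metric.infDist x (B i)) (x i) := fun i _ =>
    le_min Metric.infDist_nonneg (hx.1 i)
  have hn : (0 : ℝ) < Fintype.card ι := by exact_mod_cast Fintype.card_pos
  have hzero : h x = 0 := by
    refine le_antisymm (le_of_forall_pos_le_add fun ε hε => ?_) (sum_nonneg hterm)
    obtain ⟨y, hy, hyB⟩ := exists_mem_stdSimplex_near B hcover (div_pos hε hn)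
    have hle : h y ≤ ∑ _i : ι, ε / Fintype.card ι := by
      refine sum_le_sum fun i _ => ?_
      rcases hyB i with hi | ⟨z, hz, hyz⟩
      · exact (min_le_right _ _).trans hi
      · exact (min_le_left _ _).trans ((Metric.infDist_le_dist_of_mem hz).trans hyz)
    rw [sum_const, card_univ, nsmul_eq_mul, mul_div_cancel₀ _ hn.ne'] at hle
    have := isMinOn_iff.1 hmin y hy
    linarith
  refine ⟨x, hx, fun i => ?_⟩
  have hi := (sum_eq_zero_iff_of_nonneg hterm).1 hzero i (mem_univ i)
  rcases min_choice (Metric.infDist x (B i)) (x i) with h' | h'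
  · exact ((hclosed i).mem_iff_infDist_zero (hne i)).2 (h' ▸ hi)
  · exact hfacet i x hx (h' ▸ hi)

end Simplex


/-- The face of the standard simplex `Δ^{k-1}` corresponding to a nonempty set
`σ ⊆ {1,…,k}` of vertices: the points of the simplex supported on `σ`. -/
def simplexFace (k : ℕ) (σ : Finset (Fin k)) : Set (Fin k → ℝ) :=
  {x ∈ stdSimplex ℝ (Fin k) | ∀ i ∉ σ, x i = 0}

/-- **The KKM theorem.** If `(A_1, …, A_k)` is a KKM cover of the standard simplex
`Δ^{k-1}` by closed sets, then `⋂_{i=1}^k A_i ≠ ∅`. -/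
theorem kkm_theorem (k : ℕ) (hk : 1 ≤ k) (A : Fin k → Set (Fin k → ℝ))
    (hclosed : ∀ i, IsClosed (A i))
    (hsub : ∀ i, A i ⊆ stdSimplex ℝ (Fin k))
    (hKKM : ∀ σ : Finset (Fin k), σ.Nonempty → simplexFace k σ ⊆ ⋃ i ∈ σ, A i) :
    (⋂ i, A i).Nonempty := by
  classical
  have : Nonempty (Fin k) := ⟨⟨0, hk⟩⟩
  have hne : ∀ i, (A i).Nonempty := by
    intro i
    have hmem : Pi.single i 1 ∈ simplexFace k {i} :=
      ⟨single_mem_stdSimplex ℝ i, fun j hj => Pi.single_eq_of_ne (by simpa using hj) _⟩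
    exact ⟨_, by simpa using hKKM {i} (singleton_nonempty i) hmem⟩
  let d : Fin k → (Fin k → ℝ) → ℝ := fun i x => Metric.infDist x (A i)
  have hd : ∀ i, Continuous (d i) := fun i => Metric.continuous_infDist_pt _
  have hd0 : ∀ i x, 0 ≤ d i x := fun i x => Metric.infDist_nonneg
  have hsum : ∀ x ∈ stdSimplex ℝ (Fin k), ∑ i, x i * ∑ j, d j x = ∑ i, d i x := by
    intro x hx
    rw [← sum_mul, hx.2, one_mul]
  obtain ⟨x, hx, hxB⟩ := exists_mem_forall_of_facet_subset
    (B := fun i => {x | x i * ∑ j, d j x ≤ d i x})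
    (fun i => isClosed_le ((continuous_apply i).mul (continuous_finsetSum _ fun j _ => hd j))
      (hd i))
    (fun x hx => by
      obtain ⟨i, -, hi⟩ := exists_le_of_sum_le univ_nonempty (hsum x hx).le
      exact ⟨i, hi⟩)
    (fun i x _ hxi => by simpa [hxi] using hd0 i x)
  have heq := (sum_eq_sum_iff_of_le fun i _ => hxB i).1 (hsum x hx)
  have hsupp : ({i | x i ≠ 0} : Finset (Fin k)).Nonempty := by
    by_contra h
    rw [not_nonempty_iff_eq_empty, filter_eq_empty_iff] at h
    have h1 := hx.2
    rw [sum_eq_zero fun i hi => not_not.1 (h hi)] at h1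
    exact zero_ne_one h1
  have hface : x ∈ simplexFace k ({i | x i ≠ 0} : Finset (Fin k)) := ⟨hx, by simp⟩
  obtain ⟨i, hi, hxi⟩ := Set.mem_iUnion₂.1 (hKKM _ hsupp hface)
  have hD : ∑ j, d j x = 0 := by
    have h1 := heq i (mem_univ i)
    have h2 : d i x = 0 := Metric.infDist_zero_of_mem hxi
    rw [h2] at h1
    exact (mul_eq_zero.1 h1).resolve_left (mem_filter.1 hi).2
  refine ⟨x, Set.mem_iInter.2 fun j => ((hclosed j).mem_iff_infDist_zero (hne j)).2 ?_⟩
  exact (sum_eq_zero_iff_of_nonneg fun j _ => hd0 j x).1 hD j (mem_univ j)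
end

section
/- Let k ≥ 1 and for each j ∈ {1,…,k} let (A_1^j, …, A_k^j) be a KKM cover of Δ^{k−1} by closed sets. Then there exists a permutation π of {1,…,k} such that ⋂_{i=1}^k A_i^{π(i)} ≠ ∅. -/
/-- A finite set `σ` is dominant for the preorders induced by `r i` if every point lies below all
of `σ` in at least one of them. -/
def Dominant {V I R : Type*} [LinearOrder R] (r : I → V → R) (σ : Finset V) : Prop :=
  ∀ y, ∃ i, ∀ x ∈ σ, r i y ≤ r i x

/-- In a set with as many elements as there are colors that misses a color, the number of elements
whose removal leaves exactly the colors other than `i₀` is even. -/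
theorem even_card_removable {V I : Type*} [DecidableEq V] [Fintype I] [DecidableEq I]
    (c : V → I) (i₀ : I) {σ : Finset V}
    (hcard : σ.card = Fintype.card I) (hσ : σ.image c ≠ Finset.univ) :
    Even (σ.filter fun x => (σ.erase x).image c = Finset.univ.erase i₀).card := by
  rcases (σ.filter fun x => (σ.erase x).image c = Finset.univ.erase i₀).eq_empty_or_nonempty
    with h | ⟨x₀, hx₀⟩
  · rw [h]; simp
  rw [Finset.mem_filter] at hx₀
  obtain ⟨hx₀σ, himg⟩ := hx₀
  have hinj : Set.InjOn c (σ.erase x₀ : Finset V) := by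
    apply Finset.card_image_iff.mp
    rw [himg, Finset.card_erase_of_mem (Finset.mem_univ _), Finset.card_erase_of_mem hx₀σ,
      Finset.card_univ, hcard]
  have hc₀ : c x₀ ≠ i₀ := by
    intro h
    apply hσ
    rw [← Finset.insert_erase hx₀σ, Finset.image_insert, himg, h]
    exact Finset.insert_erase (Finset.mem_univ _)
  have hmem : ∀ x ∈ σ, c x ≠ i₀ := by
    intro x hx
    by_cases h : x = x₀
    · exact h ▸ hc₀
    · have : c x ∈ (σ.erase x₀).image c := Finset.mem_image_of_mem c (by simp [h, hx])
      rw [himg] at this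
      exact (Finset.mem_erase.mp this).1
  have hcov : ∀ i ≠ i₀, ∃ y ∈ σ, y ≠ x₀ ∧ c y = i := by
    intro i hi
    have : i ∈ (σ.erase x₀).image c := by rw [himg]; simp [hi]
    obtain ⟨y, hy, rfl⟩ := Finset.mem_image.mp this
    exact ⟨y, Finset.mem_of_mem_erase hy, Finset.ne_of_mem_erase hy, rfl⟩
  obtain ⟨x₁, hx₁σ, hx₁, hcx⟩ := hcov _ hc₀
  have : (σ.filter fun x => (σ.erase x).image c = Finset.univ.erase i₀) = {x₀, x₁} := by
    ext y
    simp only [Finset.mem_filter, Finset.mem_insert, Finset.mem_singleton]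
    constructor
    · rintro ⟨hy, hyi⟩
      by_cases hyx : y = x₀
      · exact Or.inl hyx
      right
      have : c y ∈ (σ.erase y).image c := by rw [hyi]; simp [hmem y hy]
      obtain ⟨z, hz, hzy⟩ := Finset.mem_image.mp this
      rw [Finset.mem_erase] at hz
      by_cases hzx : z = x₀
      · subst hzx
        exact hinj (by simp [hy, hyx]) (by simp [hx₁σ, hx₁]) (hzy.symm.trans hcx.symm)
      · exact absurd (hinj (by simp [hz.2, hzx]) (by simp [hy, hyx]) hzy) hz.1
    · rintro (rfl | rfl)
      · exact ⟨hx₀σ, himg⟩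
      · refine ⟨hx₁σ, ?_⟩
        ext i
        simp only [Finset.mem_image, Finset.mem_erase, Finset.mem_univ, and_true]
        constructor
        · rintro ⟨x, hx, rfl⟩
          exact hmem x hx.2
        · intro hi
          obtain ⟨z, hz, hz₀, rfl⟩ := hcov i hi
          by_cases h : z = y
          · exact ⟨x₀, ⟨hx₁.symm, hx₀σ⟩, by rw [h, hcx]⟩
          · exact ⟨z, ⟨h, hz⟩, rfl⟩
  rw [this, Finset.card_pair hx₁.symm]
  exact even_two

section Scarf

variable {V I R : Type*} [Fintype V] [DecidableEq V] [Fintype I] [DecidableEq I] [LinearOrder R]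
  {r : I → V → R}

open Classical in
/-- A dominant set with one element fewer than the number of orders extends in exactly two ways
to a dominant set with one more element, unless it lies at the boundary. -/
theorem Dominant.card_extensions (hr : ∀ i, Function.Injective (r i)) {τ : Finset V}
    (hne : τ.Nonempty) (hcard : τ.card + 1 = Fintype.card I) (hτ : Dominant r τ)
    (hM : ∀ a, ∃ y, ∀ j ≠ a, ∃ x ∈ τ, r j x < r j y) :
    (Finset.univ.filter fun x => x ∉ τ ∧ Dominant r (insert x τ)).card = 2 := by
  have hmin : ∀ i, ∃ x ∈ τ, ∀ x' ∈ τ, r i x ≤ r i x' := fun i =>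
    τ.exists_min_image (r i) hne
  choose m hmem hmle using hmin
  have hsurj : ∀ t ∈ τ, ∃ i, m i = t := by
    intro t ht
    obtain ⟨i, hi⟩ := hτ t
    exact ⟨i, hr i (le_antisymm (hmle i t ht) (hi _ (hmem i)))⟩
  obtain ⟨a, -, b, -, hab, hmab⟩ :=
    Finset.exists_ne_map_eq_of_card_lt_of_maps_to (s := Finset.univ) (t := τ) (f := m)
      (by rw [Finset.card_univ]; omega) (fun i _ => hmem i)
  have hinj : Set.InjOn m (Finset.univ.erase a : Finset I) := by
    apply Finset.card_image_iff.mp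
    have : Finset.image m (Finset.univ.erase a) = τ := by
      ext t
      simp only [Finset.mem_image, Finset.mem_erase, Finset.mem_univ, and_true]
      constructor
      · rintro ⟨i, -, rfl⟩; exact hmem i
      · intro ht
        obtain ⟨i, rfl⟩ := hsurj t ht
        by_cases h : i = a
        · exact ⟨b, hab.symm, by rw [h, hmab]⟩
        · exact ⟨i, h, rfl⟩
    rw [this, Finset.card_erase_of_mem (Finset.mem_univ _), Finset.card_univ]
    omega
  let P : I → V → Prop := fun a x =>
    (∀ j ≠ a, r j (m j) < r j x) ∧ ∀ y, (∀ j ≠ a, r j (m j) < r j y) → r a y ≤ r a x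
  have hPex : ∀ a, ∃ x, P a x := by
    intro a
    obtain ⟨y, hy⟩ := hM a
    obtain ⟨x, hx, hxm⟩ := Finset.exists_max_image
      (Finset.univ.filter fun y => ∀ j ≠ a, r j (m j) < r j y) (r a)
      ⟨y, by
        simp only [Finset.mem_filter, Finset.mem_univ, true_and]
        intro j hj
        obtain ⟨x, hx, hlt⟩ := hy j hj
        exact (hmle j x hx).trans_lt hlt⟩
    simp only [Finset.mem_filter, Finset.mem_univ, true_and] at hx hxm
    exact ⟨x, hx, hxm⟩
  have hPle : ∀ a x, P a x → r a x ≤ r a (m a) := by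
    intro a x hx
    obtain ⟨i, hi⟩ := hτ x
    by_cases h : i = a
    · subst h; exact hi _ (hmem i)
    · exact absurd (hi _ (hmem i)) (not_le.mpr (hx.1 i h))
  have hPext : ∀ a b x, a ≠ b → m a = m b → P a x → x ∉ τ ∧ Dominant r (insert x τ) := by
    intro a b x hab hmab hx
    constructor
    · intro hxt
      obtain ⟨j, rfl⟩ := hsurj x hxt
      by_cases h : j = a
      · subst h
        have := hx.1 b hab.symm
        rw [hmab] at this
        exact lt_irrefl _ this
      · exact lt_irrefl _ (hx.1 j h)
    · intro y
      by_cases h : ∀ j ≠ a, r j (m j) < r j y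
      · refine ⟨a, fun z hz => ?_⟩
        have h1 := hx.2 y h
        rcases Finset.mem_insert.mp hz with rfl | hz
        · exact h1
        · exact h1.trans ((hPle a x hx).trans (hmle a z hz))
      · push Not at h
        obtain ⟨j, hj, hjy⟩ := h
        refine ⟨j, fun z hz => ?_⟩
        rcases Finset.mem_insert.mp hz with rfl | hz
        · exact hjy.trans (hx.1 j hj).le
        · exact hjy.trans (hmle j z hz)
  have hext : ∀ x, x ∉ τ → Dominant r (insert x τ) → P a x ∨ P b x := by
    intro x hxτ hD
    obtain ⟨i₀, hi₀⟩ := hD x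
    have hlt : ∀ t ∈ τ, ∀ i, r i x ≤ r i t → r i x < r i t := fun t ht i h =>
      lt_of_le_of_ne h fun he => hxτ (hr i he ▸ ht)
    have hex : ∀ t : τ, ∃ j, m j = t ∧ r j (m j) ≤ r j x := by
      rintro ⟨t, ht⟩
      obtain ⟨j, hj⟩ := hD t
      have : m j = t := hr j (le_antisymm (hmle j t ht) (hj _ (by simp [hmem])))
      exact ⟨j, this, this ▸ hj x (by simp)⟩
    choose g hgm hgx using hex
    have hg_inj : Function.Injective g := fun t t' h => by
      apply Subtype.ext; rw [← hgm t, ← hgm t', h]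
    have hg_ne : ∀ t i, r i x ≤ r i (m i) → g t ≠ i := by
      rintro t i h rfl
      exact absurd (hgx t) (not_le.mpr (hlt _ (hmem _) _ h))
    have hi₀m := hi₀ (m i₀) (by simp [hmem])
    have hstrict : ∀ j ≠ i₀, r j (m j) < r j x := by
      intro j hj
      by_contra! hle
      have h1 : (Finset.univ.image g) ⊆ (Finset.univ.erase i₀).erase j := by
        intro i hi
        obtain ⟨t, -, rfl⟩ := Finset.mem_image.mp hi
        simp [hg_ne t _ hi₀m, hg_ne t _ hle]
      have h2 := Finset.card_le_card h1
      rw [Finset.card_image_of_injective _ hg_inj, Finset.card_erase_of_mem (by simp [hj]),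
        Finset.card_erase_of_mem (by simp), Finset.card_univ, Finset.card_univ,
        Fintype.card_coe] at h2
      have := Finset.card_pos.mpr hne
      omega
    have hP : P i₀ x := by
      refine ⟨hstrict, fun y hy => ?_⟩
      obtain ⟨i, hi⟩ := hD y
      by_cases h : i = i₀
      · subst h; exact hi x (by simp)
      · exact absurd (hi (m i) (by simp [hmem])) (not_le.mpr (hy i h))
    by_cases ha : i₀ = a
    · exact Or.inl (ha ▸ hP)
    right
    by_cases hb : i₀ = b
    · exact hb ▸ hP
    exfalso
    have hgi := hg_ne ⟨m i₀, hmem i₀⟩ i₀ hi₀m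
    have hgm' := hgm ⟨m i₀, hmem i₀⟩
    simp only at hgm'
    by_cases hga : g ⟨m i₀, hmem i₀⟩ = a
    · rw [hga, hmab] at hgm'
      exact hb (hinj (by simp [hab.symm]) (by simp [ha]) hgm').symm
    · exact hgi (hinj (by simp [hga]) (by simp [ha]) hgm')
  obtain ⟨xa, hxa⟩ := hPex a
  obtain ⟨xb, hxb⟩ := hPex b
  have hP_unique : ∀ a x x', P a x → P a x' → x = x' := fun a x x' h h' =>
    hr a (le_antisymm (h'.2 x h.1) (h.2 x' h'.1))
  have hxab : xa ≠ xb := by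
    rintro rfl
    exact absurd (hPle a _ hxa) (not_le.mpr (hxb.1 a hab))
  rw [Finset.card_eq_two]
  refine ⟨xa, xb, hxab, ?_⟩
  ext x
  simp only [Finset.mem_filter, Finset.mem_univ, true_and, Finset.mem_insert,
    Finset.mem_singleton]
  constructor
  · rintro ⟨h1, h2⟩
    exact (hext x h1 h2).imp (fun h => hP_unique _ _ _ h hxa) fun h => hP_unique _ _ _ h hxb
  · rintro (rfl | rfl)
    · exact hPext a b _ hab hmab hxa
    · exact hPext b a _ hab.symm hmab.symm hxb

open Classical in
/-- **Scarf's lemma** in Sperner form: given a coloring and slack points `s i`, which are lowest in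
the `i`-th order, above all ordinary points in the other orders, and of color `i`, some
dominant set carries all colors. -/
theorem exists_dominant_image_eq_univ [Nonempty I] (hr : ∀ i, Function.Injective (r i))
    (s : I → V) (hs_le : ∀ i x, r i (s i) ≤ r i x)
    (hs_lt : ∀ i j x, i ≠ j → x ∉ Set.range s → r i x < r i (s j))
    (hreal : ∃ x, x ∉ Set.range s) (c : V → I) (hc : ∀ i, c (s i) = i) :
    ∃ σ : Finset V, Dominant r σ ∧ σ.image c = Finset.univ := by
  by_contra! hno
  obtain ⟨i₀⟩ := ‹Nonempty I›
  have hs : Function.Injective s := fun i j h => by rw [← hc i, h, hc]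
  let D : Finset (Finset V) := Finset.univ.filter fun τ =>
    τ.card + 1 = Fintype.card I ∧ Dominant r τ ∧ τ.image c = Finset.univ.erase i₀
  let S : Finset (Finset V) := Finset.univ.filter fun σ =>
    σ.card = Fintype.card I ∧ Dominant r σ
  have hcount : ∑ τ ∈ D, (Finset.univ.filter fun x => x ∉ τ ∧ Dominant r (insert x τ)).card =
      ∑ σ ∈ S, (σ.filter fun x => (σ.erase x).image c = Finset.univ.erase i₀).card := by
    rw [← Finset.card_sigma, ← Finset.card_sigma]
    refine Finset.card_nbij' (fun p => ⟨insert p.2 p.1, p.2⟩) (fun p => ⟨p.1.erase p.2, p.2⟩)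
      ?_ ?_ ?_ ?_
    · rintro ⟨τ, x⟩ h
      simp only [Finset.coe_sigma, Set.mem_sigma_iff, Finset.mem_coe, D, S, Finset.mem_filter,
        Finset.mem_univ, true_and] at h ⊢
      obtain ⟨⟨h1, h2, h3⟩, h4, h5⟩ := h
      simp [Finset.card_insert_of_notMem h4, h1, h5, h3, Finset.erase_insert h4]
    · rintro ⟨σ, x⟩ h
      simp only [Finset.coe_sigma, Set.mem_sigma_iff, Finset.mem_coe, D, S, Finset.mem_filter,
        Finset.mem_univ, true_and] at h ⊢
      obtain ⟨⟨h1, h2⟩, h3, h4⟩ := h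
      refine ⟨⟨by rw [Finset.card_erase_add_one h3, h1], fun y => ?_, h4⟩, by simp,
        by rwa [Finset.insert_erase h3]⟩
      obtain ⟨i, hi⟩ := h2 y
      exact ⟨i, fun z hz => hi z (Finset.mem_of_mem_erase hz)⟩
    · rintro ⟨τ, x⟩ h
      simp only [Finset.coe_sigma, Set.mem_sigma_iff, Finset.mem_coe, Finset.mem_filter] at h
      simp [Finset.erase_insert h.2.2.1]
    · rintro ⟨σ, x⟩ h
      simp only [Finset.coe_sigma, Set.mem_sigma_iff, Finset.mem_coe, Finset.mem_filter] at h
      simp [Finset.insert_erase h.2.1]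
  have heven : Even (∑ σ ∈ S,
      (σ.filter fun x => (σ.erase x).image c = Finset.univ.erase i₀).card) := by
    refine Finset.even_sum _ fun σ hσ => ?_
    simp only [S, Finset.mem_filter, Finset.mem_univ, true_and] at hσ
    exact even_card_removable c i₀ hσ.1 (hno σ hσ.2)
  let τ₀ : Finset V := (Finset.univ.erase i₀).image s
  have hτ₀ : ∀ x, x ∈ τ₀ ↔ ∃ i ≠ i₀, s i = x := by simp [τ₀]
  have hτ₀D : τ₀ ∈ D := by
    simp only [D, Finset.mem_filter, Finset.mem_univ, true_and]
    refine ⟨?_, fun y => ?_, ?_⟩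
    · rw [Finset.card_image_of_injective _ hs, Finset.card_erase_add_one (Finset.mem_univ _),
        Finset.card_univ]
    · by_cases hy : y ∈ Set.range s
      · obtain ⟨j, rfl⟩ := hy
        exact ⟨j, fun x _ => hs_le j x⟩
      · refine ⟨i₀, fun x hx => ?_⟩
        obtain ⟨j, hj, rfl⟩ := (hτ₀ x).mp hx
        exact (hs_lt _ _ _ hj.symm hy).le
    · rw [Finset.image_image]
      rw [show c ∘ s = id from funext hc, Finset.image_id]
  have hone : (Finset.univ.filter fun x => x ∉ τ₀ ∧ Dominant r (insert x τ₀)).card = 1 := by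
    obtain ⟨x₀, hx₀, hmax⟩ := Finset.exists_max_image
      (Finset.univ.filter fun x => x ∉ Set.range s) (r i₀) (by
        obtain ⟨x, hx⟩ := hreal
        exact ⟨x, by simpa using hx⟩)
    simp only [Finset.mem_filter, Finset.mem_univ, true_and] at hx₀ hmax
    rw [Finset.card_eq_one]
    refine ⟨x₀, ?_⟩
    ext x
    simp only [Finset.mem_filter, Finset.mem_univ, true_and, Finset.mem_singleton]
    constructor
    · rintro ⟨hx, hD⟩
      have hkey : ∀ y, y ∉ Set.range s → r i₀ y ≤ r i₀ x := by
        intro y hy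
        obtain ⟨i, hi⟩ := hD y
        by_cases h : i = i₀
        · exact h ▸ hi x (by simp)
        · have h1 := hi (s i) (Finset.mem_insert_of_mem ((hτ₀ _).mpr ⟨i, h, rfl⟩))
          exact absurd ⟨i, hr i (le_antisymm (hs_le i y) h1)⟩ hy
      have hxr : x ∉ Set.range s := by
        rintro ⟨j, rfl⟩
        by_cases h : j = i₀
        · subst h
          exact hx₀ ⟨j, hr j (le_antisymm (hs_le j x₀) (hkey x₀ hx₀))⟩
        · exact hx ((hτ₀ _).mpr ⟨j, h, rfl⟩)
      exact hr i₀ (le_antisymm (hmax x hxr) (hkey x₀ hx₀))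
    · rintro rfl
      refine ⟨fun h => ?_, fun y => ?_⟩
      · obtain ⟨j, -, rfl⟩ := (hτ₀ _).mp h
        exact hx₀ ⟨j, rfl⟩
      · by_cases hy : y ∈ Set.range s
        · obtain ⟨j, rfl⟩ := hy
          exact ⟨j, fun x _ => hs_le j x⟩
        · refine ⟨i₀, fun z hz => ?_⟩
          rcases Finset.mem_insert.mp hz with rfl | hz
          · exact hmax y hy
          · obtain ⟨j, hj, rfl⟩ := (hτ₀ z).mp hz
            exact (hs_lt _ _ _ hj.symm hy).le
  have hrest : Even (∑ τ ∈ D.erase τ₀,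
      (Finset.univ.filter fun x => x ∉ τ ∧ Dominant r (insert x τ)).card) := by
    refine Finset.even_sum _ fun τ hτ => ?_
    simp only [D, Finset.mem_erase, Finset.mem_filter, Finset.mem_univ, true_and] at hτ
    obtain ⟨hne, hcard, hdom, himg⟩ := hτ
    have hex : ∃ x ∈ τ, x ∉ Set.range s := by
      by_contra! hall
      apply hne
      ext x
      rw [hτ₀]
      constructor
      · intro hx
        obtain ⟨i, rfl⟩ := hall x hx
        have : c (s i) ∈ τ.image c := Finset.mem_image_of_mem c hx
        rw [himg, hc] at this
        exact ⟨i, (Finset.mem_erase.mp this).1, rfl⟩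
      · rintro ⟨i, hi, rfl⟩
        have : i ∈ τ.image c := by rw [himg]; simp [hi]
        obtain ⟨t, ht, rfl⟩ := Finset.mem_image.mp this
        obtain ⟨j, rfl⟩ := hall t ht
        rwa [hc]
    obtain ⟨x, hx, hxr⟩ := hex
    rw [hdom.card_extensions hr ⟨x, hx⟩ hcard
      fun a => ⟨s a, fun j hj => ⟨x, hx, hs_lt j a x hj hxr⟩⟩]
    exact even_two
  rw [← hcount, ← Finset.add_sum_erase D _ hτ₀D, hone] at heven
  exact Nat.not_even_one ((Nat.even_add.mp heven).mpr hrest)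

end Scarf

/-- In any coloring of the grid points of a simplex, some grid point is close, for every color `i`,
to the facet opposite to the vertex `i` or to a point of color `i`. -/
theorem exists_grid_point_near_all_colors {I : Type*} [Fintype I] [DecidableEq I] [Nonempty I]
    (n : ℕ) (c : (I → ℕ) → I) :
    ∃ x : I → ℕ, ∑ i, x i = n ∧ ∀ i, x i ≤ Fintype.card I ∨
      ∃ x' : I → ℕ, ∑ j, x' j = n ∧ c x' = i ∧
        ∀ j, x' j ≤ x j + Fintype.card I ∧ x j ≤ x' j + Fintype.card I := by
  let T := Finset.piAntidiag (Finset.univ : Finset I) n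
  have hT : ∀ x : I → ℕ, x ∈ T ↔ ∑ i, x i = n := fun x => by simp [T]
  let e : (T ⊕ I) ≃ Fin (Fintype.card (T ⊕ I)) := Fintype.equivFin _
  let level : I → T ⊕ I → ℕ := fun i =>
    Sum.elim (fun x => x.1 i + 1) fun j => if i = j then 0 else n + 2
  let r : I → T ⊕ I → ℕ ×ₗ Fin (Fintype.card (T ⊕ I)) := fun i v => toLex (level i v, e v)
  have hr_lt : ∀ i v w, level i v < level i w → r i v < r i w := fun i v w h =>
    Prod.Lex.toLex_lt_toLex.mpr (Or.inl h)
  have hr_le : ∀ i v w, r i v ≤ r i w → level i v ≤ level i w := fun i v w h => by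
    by_contra! hlt
    exact absurd h (not_le.mpr (hr_lt i w v hlt))
  have hr : ∀ i, Function.Injective (r i) := fun i v w h =>
    e.injective (congrArg Prod.snd (toLex.injective h))
  have hTle : ∀ (x : T) i, x.1 i ≤ n := fun x i => by
    have h := (hT _).mp x.2
    rw [← h]
    exact Finset.single_le_sum (f := x.1) (fun _ _ => Nat.zero_le _) (Finset.mem_univ i)
  obtain ⟨i₁⟩ := id ‹Nonempty I›
  have hs_le : ∀ i x, r i (Sum.inr i) ≤ r i x := by
    intro i x
    rcases x with x | j
    · exact (hr_lt _ _ _ (by simp [level])).le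
    · by_cases h : i = j
      · rw [h]
      · exact (hr_lt _ _ _ (by simp [level, h])).le
  have hs_lt : ∀ i j x, i ≠ j → x ∉ Set.range (Sum.inr : I → T ⊕ I) →
      r i x < r i (Sum.inr j) := by
    intro i j x hij hx
    rcases x with x | l
    · refine hr_lt _ _ _ ?_
      have := hTle x i
      simp only [level, Sum.elim_inl, Sum.elim_inr, hij, if_false]
      omega
    · exact absurd ⟨l, rfl⟩ hx
  have hpoint : ∀ ℓ : I → ℕ, ∑ i, ℓ i ≤ n → ∃ y : T, ∀ i, ℓ i ≤ y.1 i := by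
    intro ℓ hℓ
    refine ⟨⟨ℓ + Pi.single i₁ (n - ∑ i, ℓ i), (hT _).mpr ?_⟩, fun i => by simp⟩
    simp only [Pi.add_apply, Finset.sum_add_distrib, Finset.sum_pi_single', Finset.mem_univ,
      if_true]
    omega
  obtain ⟨σ, hσ, himg⟩ := exists_dominant_image_eq_univ hr Sum.inr hs_le hs_lt
    (by
      obtain ⟨y, -⟩ := hpoint 0 (by simp)
      exact ⟨Sum.inl y, by simp⟩)
    (Sum.elim (fun x => c x.1) id) (fun i => rfl)
  have hcolor : ∀ i, ∃ v ∈ σ, Sum.elim (fun x : T => c x.1) id v = i := fun i => by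
    have : i ∈ σ.image (Sum.elim (fun x : T => c x.1) id) := by rw [himg]; simp
    simpa only [Finset.mem_image] using this
  have hσne : σ.Nonempty := by
    obtain ⟨v, hv, -⟩ := hcolor i₁
    exact ⟨v, hv⟩
  choose m hm hmle using fun i => σ.exists_min_image (level i) hσne
  have hsum : n < ∑ i, level i (m i) := by
    by_contra! h
    obtain ⟨y, hy⟩ := hpoint _ h
    obtain ⟨i, hi⟩ := hσ (Sum.inl y)
    have h1 := hr_le _ _ _ (hi _ (hm i))
    have h2 := hy i
    simp only [level, Sum.elim_inl] at h1 h2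
    omega
  have hlow : ∀ (x : T), Sum.inl x ∈ σ → ∀ i, level i (m i) ≤ x.1 i + 1 := fun x hx i =>
    hmle i _ hx
  have hupp : ∀ (x : T), Sum.inl x ∈ σ → ∀ i, x.1 i + 1 < level i (m i) + Fintype.card I := by
    intro x hx i
    have h1 : ∑ j ∈ Finset.univ.erase i, level j (m j) ≤
        ∑ j ∈ Finset.univ.erase i, (x.1 j + 1) :=
      Finset.sum_le_sum fun j _ => hlow x hx j
    have h2 := Finset.add_sum_erase Finset.univ (fun j => level j (m j)) (Finset.mem_univ i)
    have h3 := Finset.add_sum_erase Finset.univ (fun j => x.1 j + 1) (Finset.mem_univ i)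
    have h4 : ∑ j, (x.1 j + 1) = n + Fintype.card I := by
      rw [Finset.sum_add_distrib, (hT _).mp x.2]
      simp
    omega
  have hreal : ∃ x : T, Sum.inl x ∈ σ := by
    by_contra! hno
    obtain ⟨y, -⟩ := hpoint 0 (by simp)
    obtain ⟨i, hi⟩ := hσ (Sum.inl y)
    obtain ⟨v, hv, hvi⟩ := hcolor i
    rcases v with x | j
    · exact hno x hv
    · simp only [Sum.elim_inr, id] at hvi
      subst hvi
      have := hr_le _ _ _ (hi _ hv)
      simp [level] at this
  obtain ⟨x, hx⟩ := hreal
  refine ⟨x.1, (hT _).mp x.2, fun i => ?_⟩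
  obtain ⟨v, hv, hvi⟩ := hcolor i
  rcases v with x' | j
  · refine Or.inr ⟨x'.1, (hT _).mp x'.2, hvi, fun j => ?_⟩
    have := hlow x hx j
    have := hlow x' hv j
    have := hupp x hx j
    have := hupp x' hv j
    omega
  · left
    simp only [Sum.elim_inr, id] at hvi
    subst hvi
    have h1 := hmle j _ hv
    have h2 := hupp x hx j
    simp only [level, Sum.elim_inr, if_true] at h1 h2
    omega

/-- The dual KKM theorem: if closed sets `B i` cover the simplex and each `B i` contains the facet
opposite to the vertex `i`, then they have a common point. -/
theorem exists_forall_mem_of_facet_subset {I : Type*} [Fintype I] [Nonempty I]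
    (B : I → Set (I → ℝ)) (hB : ∀ i, IsClosed (B i)) (hcov : stdSimplex ℝ I ⊆ ⋃ i, B i)
    (hfacet : ∀ i, ∀ x ∈ stdSimplex ℝ I, x i = 0 → x ∈ B i) :
    ∃ x ∈ stdSimplex ℝ I, ∀ i, x ∈ B i := by
  classical
  let K : ℝ → Set (I → ℝ) := fun ε =>
    stdSimplex ℝ I ∩ ⋂ i, ({x | x i ≤ ε} ∪ Metric.cthickening ε (B i))
  have hKclosed : ∀ ε, IsClosed (K ε) := fun ε =>
    (isClosed_stdSimplex ℝ I).inter (isClosed_iInter fun i =>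
      (isClosed_le (continuous_apply i) continuous_const).union Metric.isClosed_cthickening)
  have hKmono : ∀ {ε δ : ℝ}, ε ≤ δ → K ε ⊆ K δ := fun h =>
    Set.inter_subset_inter_right _ (Set.iInter_mono fun i =>
      Set.union_subset_union (fun x hx => le_trans hx h) (Metric.cthickening_mono h _))
  have hKne : ∀ ε > 0, (K ε).Nonempty := by
    intro ε hε
    obtain ⟨n, hn⟩ := exists_nat_gt ((Fintype.card I : ℝ) / ε)
    have hn0 : (0 : ℝ) < n := lt_of_le_of_lt (by positivity) hn
    have hkn : (Fintype.card I : ℝ) / n ≤ ε := by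
      rw [div_lt_iff₀ hε] at hn
      rw [div_le_iff₀ hn0]
      linarith
    let p : (I → ℕ) → I → ℝ := fun x i => x i / n
    have hp : ∀ x : I → ℕ, ∑ i, x i = n → p x ∈ stdSimplex ℝ I := by
      intro x hx
      refine ⟨fun i => by positivity, ?_⟩
      simp only [p]
      rw [← Finset.sum_div, ← Nat.cast_sum, hx, div_self hn0.ne']
    have hc : ∀ x : I → ℕ, ∃ i, ∑ j, x j = n → p x ∈ B i := by
      intro x
      by_cases hx : ∑ j, x j = n
      · obtain ⟨i, hi⟩ := Set.mem_iUnion.mp (hcov (hp x hx))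
        exact ⟨i, fun _ => hi⟩
      · exact ⟨Classical.arbitrary I, fun h => absurd h hx⟩
    choose c hc using hc
    obtain ⟨x, hx, hnear⟩ := exists_grid_point_near_all_colors n c
    refine ⟨p x, hp x hx, Set.mem_iInter.mpr fun i => ?_⟩
    rcases hnear i with h | ⟨x', hx', hi, hd⟩
    · left
      refine le_trans ?_ hkn
      have : (x i : ℝ) ≤ Fintype.card I := by exact_mod_cast h
      simp only [p]
      gcongr
    · right
      refine Metric.mem_cthickening_of_dist_le _ (p x') _ _ (hi ▸ hc x' hx') (le_trans ?_ hkn)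
      refine (dist_pi_le_iff (by positivity)).mpr fun j => ?_
      have h1 : (x' j : ℝ) ≤ x j + Fintype.card I := by exact_mod_cast (hd j).1
      have h2 : (x j : ℝ) ≤ x' j + Fintype.card I := by exact_mod_cast (hd j).2
      simp only [p]
      rw [Real.dist_eq, ← sub_div, abs_div, abs_of_pos hn0]
      gcongr
      rw [abs_le]
      constructor <;> linarith
  obtain ⟨x, hx⟩ := IsCompact.nonempty_iInter_of_sequence_nonempty_isCompact_isClosed
    (fun n : ℕ => K (1 / ((n : ℝ) + 1)))
    (fun n => hKmono (by push_cast; gcongr; linarith))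
    (fun n => hKne _ (by positivity))
    ((isCompact_stdSimplex ℝ I).of_isClosed_subset (hKclosed _) Set.inter_subset_left)
    (fun n => hKclosed _)
  have hxK : ∀ ε > 0, x ∈ K ε := fun ε hε => by
    obtain ⟨n, hn⟩ := exists_nat_one_div_lt hε
    exact hKmono hn.le (Set.mem_iInter.mp hx n)
  have hxΔ : x ∈ stdSimplex ℝ I := (hxK 1 one_pos).1
  refine ⟨x, hxΔ, fun i => ?_⟩
  rcases (hxΔ.1 i).eq_or_lt with h0 | hpos
  · exact hfacet i x hxΔ h0.symm
  · rw [← (hB i).closure_eq, Metric.closure_eq_iInter_cthickening' (B i) (Set.Ioo 0 (x i))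
      (fun ε hε => ⟨min ε (x i / 2), by
        have := min_le_right ε (x i / 2)
        have : 0 < min ε (x i / 2) := by positivity
        exact ⟨⟨this, by linarith⟩, this, min_le_left _ _⟩⟩)]
    refine Set.mem_iInter₂.mpr fun δ hδ => ?_
    exact (Set.mem_iInter.mp (hxK δ hδ.1).2 i).resolve_left (not_le.mpr hδ.2)

/-- The average of continuous face-preserving self-maps of the simplex hits the barycenter. -/
theorem exists_sum_eq_one_of_facePreserving {I : Type*} [Fintype I] [Nonempty I]
    (f : I → (I → ℝ) → I → ℝ) (hf : ∀ j i, ContinuousOn (fun x => f j x i) (stdSimplex ℝ I))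
    (hsum : ∀ j, ∀ x ∈ stdSimplex ℝ I, ∑ i, f j x i = 1)
    (hface : ∀ j, ∀ x ∈ stdSimplex ℝ I, ∀ i, x i = 0 → f j x i = 0) :
    ∃ x ∈ stdSimplex ℝ I, ∀ i, ∑ j, f j x i = 1 := by
  have htot : ∀ x ∈ stdSimplex ℝ I, ∑ i, ∑ j, f j x i = ∑ _i : I, (1 : ℝ) := fun x hx => by
    rw [Finset.sum_comm]
    exact Finset.sum_congr rfl fun j _ => hsum j x hx
  obtain ⟨x, hx, hle⟩ := exists_forall_mem_of_facet_subset
    (fun i => stdSimplex ℝ I ∩ (fun x => ∑ j, f j x i) ⁻¹' Set.Iic 1)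
    (fun i => (continuousOn_finsetSum _ fun j _ => hf j i).preimage_isClosed_of_isClosed
      (isClosed_stdSimplex ℝ I) isClosed_Iic)
    (fun x hx => by
      obtain ⟨i, -, hi⟩ := Finset.exists_le_of_sum_le Finset.univ_nonempty (htot x hx).le
      exact Set.mem_iUnion.mpr ⟨i, hx, hi⟩)
    (fun i x hx h0 => ⟨hx, by
      simp [hface _ x hx i h0]⟩)
  exact ⟨x, hx, fun i => (Finset.sum_eq_sum_iff_of_le fun i _ => (hle i).2).mp (htot x hx) i
    (Finset.mem_univ i)⟩

/-- A doubly stochastic matrix has a positive generalized diagonal. -/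
theorem exists_perm_pos_of_mem_doublyStochastic {I : Type*} [Fintype I] [DecidableEq I]
    {M : Matrix I I ℝ} (hM : M ∈ doublyStochastic ℝ I) :
    ∃ π : Equiv.Perm I, ∀ i, 0 < M (π i) i := by
  obtain ⟨w, hw, hw1, rfl⟩ := exists_eq_sum_perm_of_mem_doublyStochastic hM
  obtain ⟨π, -, hπ⟩ : ∃ π ∈ Finset.univ, 0 < w π :=
    Finset.exists_lt_of_sum_lt (by simp [hw1])
  refine ⟨π⁻¹, fun i => ?_⟩
  rw [Matrix.sum_apply]
  refine Finset.sum_pos' (fun τ _ => ?_) ⟨π, Finset.mem_univ _, ?_⟩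
  · have := hw τ
    simp only [Matrix.smul_apply, Equiv.Perm.permMatrix, PEquiv.toMatrix_apply, smul_eq_mul]
    split_ifs <;> simp [this]
  · simpa [Equiv.Perm.permMatrix, PEquiv.toMatrix_apply] using hπ

/-- Approximate form of the colorful KKM theorem. -/
theorem exists_perm_infDist_lt {k : ℕ} [NeZero k] (A : Fin k → Fin k → Set (Fin k → ℝ))
    (hKKM : ∀ j, ∀ σ : Finset (Fin k), σ.Nonempty → simplexFace k σ ⊆ ⋃ i ∈ σ, A j i)
    {ε : ℝ} (hε : 0 < ε) :
    ∃ π : Equiv.Perm (Fin k), ∃ x ∈ stdSimplex ℝ (Fin k),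
      ∀ i, Metric.infDist x (A (π i) i) < ε := by
  let w : Fin k → (Fin k → ℝ) → Fin k → ℝ := fun j x i =>
    x i * max 0 (ε - Metric.infDist x (A j i))
  have hw_cont : ∀ j i, Continuous fun x => w j x i := fun j i =>
    (continuous_apply i).mul
      (continuous_const.max (continuous_const.sub (Metric.continuous_infDist_pt _)))
  have hw_nonneg : ∀ j, ∀ x ∈ stdSimplex ℝ (Fin k), ∀ i, 0 ≤ w j x i := fun j x hx i =>
    mul_nonneg (hx.1 i) (le_max_left _ _)
  have hw_pos : ∀ j, ∀ x ∈ stdSimplex ℝ (Fin k), 0 < ∑ i, w j x i := by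
    intro j x hx
    let σ : Finset (Fin k) := Finset.univ.filter fun i => x i ≠ 0
    have hσ : σ.Nonempty := by
      obtain ⟨i, -, hi⟩ := Finset.exists_ne_zero_of_sum_ne_zero (hx.2.trans_ne one_ne_zero)
      exact ⟨i, by simpa [σ] using hi⟩
    have hmem : x ∈ ⋃ i ∈ σ, A j i := hKKM j σ hσ ⟨hx, fun i hi => by simpa [σ] using hi⟩
    obtain ⟨i, hi, hA⟩ := Set.mem_iUnion₂.mp hmem
    refine Finset.sum_pos' (fun i _ => hw_nonneg j x hx i) ⟨i, Finset.mem_univ _, ?_⟩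
    have hxi : 0 < x i := lt_of_le_of_ne (hx.1 i) (Ne.symm (by simpa [σ] using hi))
    simp only [w, Metric.infDist_zero_of_mem hA, sub_zero]
    exact mul_pos hxi (lt_max_of_lt_right hε)
  obtain ⟨x, hx, hcol⟩ := exists_sum_eq_one_of_facePreserving
    (fun j x i => w j x i / ∑ l, w j x l)
    (fun j i => (hw_cont j i).continuousOn.div
      (continuous_finsetSum _ fun l _ => hw_cont j l).continuousOn
      fun x hx => (hw_pos j x hx).ne')
    (fun j x hx => by rw [← Finset.sum_div, div_self (hw_pos j x hx).ne'])
    (fun j x hx i h => by simp [w, h])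
  have hM : (Matrix.of fun j i => w j x i / ∑ l, w j x l) ∈ doublyStochastic ℝ (Fin k) := by
    rw [mem_doublyStochastic_iff_sum]
    refine ⟨fun j i => div_nonneg (hw_nonneg j x hx i) (hw_pos j x hx).le, fun j => ?_, hcol⟩
    simp only [Matrix.of_apply]
    rw [← Finset.sum_div, div_self (hw_pos j x hx).ne']
  obtain ⟨π, hπ⟩ := exists_perm_pos_of_mem_doublyStochastic hM
  refine ⟨π, x, hx, fun i => ?_⟩
  by_contra! hle
  refine (hπ i).ne' ?_
  simp [w, max_eq_left (sub_nonpos.mpr hle)]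

/-- **Gale's colorful KKM theorem.** If for each `j ∈ [k]` the family
`(A_1^j, …, A_k^j)` is a KKM cover of `Δ^{k-1}` by closed sets, then there is a
permutation `π` of `[k]` such that `⋂_{i=1}^k A_i^{π(i)} ≠ ∅`. -/
theorem colorful_kkm (k : ℕ) (hk : 1 ≤ k)
    (A : Fin k → Fin k → Set (Fin k → ℝ))
    (hclosed : ∀ j i, IsClosed (A j i))
    (hsub : ∀ j i, A j i ⊆ stdSimplex ℝ (Fin k))
    (hKKM : ∀ j, ∀ σ : Finset (Fin k), σ.Nonempty →
      simplexFace k σ ⊆ ⋃ i ∈ σ, A j i) :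
    ∃ π : Equiv.Perm (Fin k), (⋂ i, A (π i) i).Nonempty := by
  have : NeZero k := ⟨by omega⟩
  have hne : ∀ j i, (A j i).Nonempty := fun j i => by
    have hv : Pi.single i 1 ∈ simplexFace k {i} :=
      ⟨single_mem_stdSimplex ℝ i, fun l hl => Pi.single_eq_of_ne (by simpa using hl) 1⟩
    exact ⟨_, by simpa using hKKM j {i} (Finset.singleton_nonempty i) hv⟩
  by_contra! hno
  have hbound : ∀ π : Equiv.Perm (Fin k), ∃ ε > 0, ∀ x ∈ stdSimplex ℝ (Fin k),
      ε ≤ ∑ i, Metric.infDist x (A (π i) i) := by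
    intro π
    obtain ⟨x₀, hx₀, hmin⟩ := (isCompact_stdSimplex ℝ (Fin k)).exists_isMinOn
      ⟨_, single_mem_stdSimplex ℝ 0⟩
      (continuous_finsetSum Finset.univ fun i _ =>
        Metric.continuous_infDist_pt (A (π i) i)).continuousOn
    refine ⟨_, lt_of_le_of_ne (Finset.sum_nonneg fun i _ => Metric.infDist_nonneg) fun h0 => ?_,
      fun x hx => hmin hx⟩
    have hx₀A : x₀ ∈ ⋂ i, A (π i) i := Set.mem_iInter.mpr fun i =>
      ((hclosed _ _).mem_iff_infDist_zero (hne _ _)).mpr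
        ((Finset.sum_eq_zero_iff_of_nonneg fun i _ => Metric.infDist_nonneg).mp h0.symm i
          (Finset.mem_univ i))
    rw [hno π] at hx₀A
    exact hx₀A
  choose ε hε hεle using hbound
  obtain ⟨π₀, hπ₀⟩ := Finite.exists_min ε
  have hk0 : (0 : ℝ) < k := by exact_mod_cast hk
  obtain ⟨π, x, hx, hlt⟩ := exists_perm_infDist_lt A hKKM (div_pos (hε π₀) hk0)
  have h1 : ∑ i, Metric.infDist x (A (π i) i) < ∑ _i : Fin k, ε π₀ / k :=
    Finset.sum_lt_sum_of_nonempty Finset.univ_nonempty fun i _ => hlt i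
  rw [Finset.sum_const, Finset.card_univ, Fintype.card_fin, nsmul_eq_mul,
    mul_div_cancel₀ _ hk0.ne'] at h1
  exact absurd ((hπ₀ π).trans (hεle π x hx)) (not_le.mpr h1)
end

section
/- Let V be a finite set of points in ℝ^d and let M be a matroid with ground set V and rank function r. If 0 ∈ conv(G) for every subset G ⊆ V with r(V∖G) ≤ d, then there exists an independent set T of M such that 0 ∈ conv(T). -/
/-- The rank function of a matroid: `mrank M A` is the size of the largest
independent set of `M` contained in `A`. -/
noncomputable def mrank {α : Type*} (M : Matroid α) (A : Set α) : ℕ :=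
  sSup {n : ℕ | ∃ I ⊆ A, M.Indep I ∧ I.ncard = n}

open scoped RealInnerProductSpace

lemma mrank_closure_le_ncard {α : Type*} (M : Matroid α) {I : Set α} (hI : M.Indep I)
    (hfin : I.Finite) : mrank M (M.closure I) ≤ I.ncard := by
  refine csSup_le' ?_
  rintro n ⟨J, hJ, hJi, rfl⟩
  have h1 : J.encard ≤ I.encard := by
    rw [← hI.eRk_eq_encard, ← M.eRk_closure_eq I]
    exact hJi.encard_le_eRk_of_subset hJ
  exact ENat.toNat_le_toNat h1 (Set.encard_ne_top_iff.2 hfin)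

section InnerProductSpace

variable {E : Type*} [NormedAddCommGroup E] [InnerProductSpace ℝ E]

/-- A set whose convex hull contains `0` is not contained in an open half-space bounded by a
hyperplane through `0`. -/
lemma exists_inner_nonpos_of_zero_mem_convexHull {s : Set E} (hs : 0 ∈ convexHull ℝ s) (p : E) :
    ∃ v ∈ s, ⟪p, v⟫ ≤ 0 := by
  by_contra! hc
  have hsub : convexHull ℝ s ⊆ {v | 0 < ⟪p, v⟫} :=
    convexHull_min hc (convex_halfSpace_gt (innerₛₗ ℝ p).isLinear 0)
  simpa using hsub hs

/-- Affinely independent points on a hyperplane avoiding `0` are linearly independent. -/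
lemma AffineIndependent.linearIndependent_of_inner_eq {ι : Type*} {z : ι → E}
    (hz : AffineIndependent ℝ z) {p : E} {c : ℝ} (hc : c ≠ 0) (hzp : ∀ i, ⟪p, z i⟫ = c) :
    LinearIndependent ℝ z := by
  rw [linearIndependent_iff']
  intro s w hw
  refine (affineIndependent_iff.1 hz) s w ?_ hw
  have h1 : ⟪p, ∑ i ∈ s, w i • z i⟫ = (∑ i ∈ s, w i) * c := by
    simp [inner_sum, inner_smul_right, hzp, Finset.sum_mul]
  rw [hw, inner_zero_right] at h1
  exact (mul_eq_zero.1 h1.symm).resolve_right hc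

/-- If `p` is the point of the convex set `K` nearest to `0`, then `K` lies in the half-space
`‖p‖ ^ 2 ≤ ⟪p, x⟫`. -/
lemma Convex.norm_sq_le_inner_of_norm_le {K : Set E} (hK : Convex ℝ K) {p : E} (hp : p ∈ K)
    (hmin : ∀ q ∈ K, ‖p‖ ≤ ‖q‖) {x : E} (hx : x ∈ K) : ‖p‖ ^ 2 ≤ ⟪p, x⟫ := by
  have hinf : ‖(0 : E) - p‖ = ⨅ w : K, ‖(0 : E) - w‖ := by
    have : Nonempty K := ⟨⟨p, hp⟩⟩
    refine le_antisymm (le_ciInf fun w => by simpa using hmin w w.2) ?_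
    exact ciInf_le (f := fun w : K => ‖(0 : E) - w‖)
      ⟨0, by rintro _ ⟨w, rfl⟩; positivity⟩ ⟨p, hp⟩
  have := (norm_eq_iInf_iff_real_inner_le_zero hK hp).1 hinf x hx
  rw [zero_sub, inner_neg_left, inner_sub_right, real_inner_self_eq_norm_sq] at this
  linarith

/-- If `p` is the nonzero point of `convexHull ℝ T` nearest to `0`, then `p` is a convex combination
of at most `finrank ℝ E` points of `T`. -/
lemma exists_subset_ncard_le_finrank_of_norm_le [FiniteDimensional ℝ E] {T : Set E} {p : E}
    (hp : p ∈ convexHull ℝ T) (hp0 : p ≠ 0) (hmin : ∀ q ∈ convexHull ℝ T, ‖p‖ ≤ ‖q‖) :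
    ∃ S ⊆ T, S.Finite ∧ S.ncard ≤ Module.finrank ℝ E ∧ p ∈ convexHull ℝ S := by
  have hge : ∀ x ∈ T, ‖p‖ ^ 2 ≤ ⟪p, x⟫ := fun x hx =>
    (convex_convexHull ℝ T).norm_sq_le_inner_of_norm_le hp hmin (subset_convexHull ℝ T hx)
  obtain ⟨ι, _, z, w, hzT, hz, hw, hw1, hwp⟩ := eq_pos_convex_span_of_mem_convexHull hp
  have hsum : ∑ i, w i * (⟪p, z i⟫ - ‖p‖ ^ 2) = 0 := by
    have h1 : ∑ i, w i * ⟪p, z i⟫ = ‖p‖ ^ 2 := by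
      calc ∑ i, w i * ⟪p, z i⟫ = ⟪p, ∑ i, w i • z i⟫ := by simp [inner_sum, inner_smul_right]
        _ = ‖p‖ ^ 2 := by rw [hwp, real_inner_self_eq_norm_sq]
    simp only [mul_sub, Finset.sum_sub_distrib, ← Finset.sum_mul, h1, hw1, one_mul, sub_self]
  have heq : ∀ i, ⟪p, z i⟫ = ‖p‖ ^ 2 := by
    intro i
    have h1 := (Finset.sum_eq_zero_iff_of_nonneg fun i _ =>
      mul_nonneg (hw i).le (sub_nonneg.2 (hge _ (hzT ⟨i, rfl⟩)))).1 hsum i (Finset.mem_univ i)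
    exact sub_eq_zero.1 ((mul_eq_zero.1 h1).resolve_left (hw i).ne')
  have hlin : LinearIndependent ℝ z :=
    hz.linearIndependent_of_inner_eq (pow_ne_zero 2 (norm_ne_zero_iff.2 hp0)) heq
  refine ⟨Set.range z, hzT, Set.finite_range z, ?_, ?_⟩
  · rw [← Nat.card_coe_set_eq, Nat.card_range_of_injective hlin.injective,
      Nat.card_eq_fintype_card]
    exact hlin.fintype_card_le_finrank
  · rw [← hwp]
    exact (convex_convexHull ℝ _).sum_mem (fun i _ => (hw i).le) hw1
      fun i _ => subset_convexHull ℝ _ ⟨i, rfl⟩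

/-- A segment leaving `p ≠ 0` for a point `v` with `⟪p, v⟫ ≤ 0` contains a point nearer to `0`
than `p`. -/
lemma exists_mem_segment_norm_lt {p v : E} (hp0 : p ≠ 0) (hv : ⟪p, v⟫ ≤ 0) :
    ∃ q ∈ segment ℝ p v, ‖q‖ < ‖p‖ := by
  by_contra! hc
  have := (convex_segment p v).norm_sq_le_inner_of_norm_le (left_mem_segment ℝ p v) hc
    (right_mem_segment ℝ p v)
  have : 0 < ‖p‖ ^ 2 := by positivity
  linarith

end InnerProductSpace


/-- **Matroid colorful Carathéodory theorem** (Kalai–Meshulam). Let `V` be a finite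
set of points in `ℝ^d` and `M` a matroid with ground set `V`.  If `0 ∈ conv(G)` for
every `G ⊆ V` with `r(V ∖ G) ≤ d`, then some independent set `T` of `M` satisfies
`0 ∈ conv(T)`. -/
theorem matroid_colorful_caratheodory (d : ℕ)
    (V : Finset (EuclideanSpace ℝ (Fin d)))
    (M : Matroid (EuclideanSpace ℝ (Fin d))) (hE : M.E = ↑V)
    (h : ∀ G ⊆ (V : Set (EuclideanSpace ℝ (Fin d))),
      mrank M ((V : Set (EuclideanSpace ℝ (Fin d))) \ G) ≤ d → 0 ∈ convexHull ℝ G) :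
    ∃ T : Set (EuclideanSpace ℝ (Fin d)), M.Indep T ∧ 0 ∈ convexHull ℝ T := by
  have hclosure : ∀ I, M.Indep I → I.Finite → I.ncard ≤ d →
      0 ∈ convexHull ℝ ((V : Set (EuclideanSpace ℝ (Fin d))) \ M.closure I) := by
    intro I hI hfin hcard
    refine h _ Set.sdiff_subset ?_
    rw [Set.sdiff_sdiff_cancel_left (hE ▸ M.closure_subset_ground I)]
    exact (mrank_closure_le_ncard M hI hfin).trans hcard
  have hextend : ∀ I, M.Indep I → I.Finite → I.ncard ≤ d → ∀ p,
      ∃ v, M.Indep (insert v I) ∧ ⟪p, v⟫ ≤ 0 := by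
    intro I hI hfin hcard p
    obtain ⟨v, hv, hpv⟩ :=
      exists_inner_nonpos_of_zero_mem_convexHull (hclosure I hI hfin hcard) p
    exact ⟨v, (hI.insert_indep_iff).2 (Or.inl (by rwa [hE])), hpv⟩
  have hsub : ∀ {T}, M.Indep T → T ⊆ (V : Set (EuclideanSpace ℝ (Fin d))) := fun hT =>
    hE ▸ hT.subset_ground
  have hcompact : IsCompact (⋃ T ∈ {T | M.Indep T}, convexHull ℝ T) :=
    (V.finite_toSet.finite_subsets.subset fun _ hT => hsub hT).isCompact_biUnion
      fun _ hT => (V.finite_toSet.subset (hsub hT)).isCompact_convexHull (𝕜 := ℝ)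
  obtain ⟨v₀, hv₀, -⟩ := hextend ∅ M.empty_indep Set.finite_empty (by simp) 0
  obtain ⟨p, hp, hmin⟩ := hcompact.exists_isMinOn
    ⟨v₀, Set.mem_biUnion hv₀ (subset_convexHull ℝ _ (Set.mem_insert _ _))⟩
    continuous_norm.continuousOn
  obtain ⟨T, hT, hpT⟩ := Set.mem_iUnion₂.1 hp
  by_cases hp0 : p = 0
  · exact ⟨T, hT, hp0 ▸ hpT⟩
  obtain ⟨S, hST, hS, hcard, hpS⟩ := exists_subset_ncard_le_finrank_of_norm_le hpT hp0
    fun q hq => hmin (Set.mem_biUnion hT hq)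
  rw [finrank_euclideanSpace_fin] at hcard
  obtain ⟨v, hv, hpv⟩ := hextend S (hT.subset hST) hS hcard p
  obtain ⟨q, hq, hqp⟩ := exists_mem_segment_norm_lt hp0 hpv
  have hqv : q ∈ convexHull ℝ (insert v S) :=
    (convex_convexHull ℝ _).segment_subset (convexHull_mono (Set.subset_insert v S) hpS)
      (subset_convexHull ℝ _ (Set.mem_insert v S)) hq
  exact absurd (hmin (Set.mem_biUnion hv hqv)) (not_le.2 hqp)
end

section
/- Let F be a finite family of compact convex sets in ℝ² and let M be a matroid with ground set F, rank 4, and rank function r. If every 4-element subfamily of F of rank 4 in M can be pierced by a line, then there exist 2 lines whose union intersects every member of a subfamily F' ⊆ F satisfying r(F∖F') ≤ 3. -/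
/-- A line in `ℝ²`: a one-dimensional affine subspace. -/
def IsLine (l : Set (EuclideanSpace ℝ (Fin 2))) : Prop :=
  ∃ L : AffineSubspace ℝ (EuclideanSpace ℝ (Fin 2)),
    Module.finrank ℝ L.direction = 1 ∧ l = ↑L

/-- A combinatorial lemma of Sperner type: a labelling of the grid `{0, …, p}³` by four labels which
satisfies boundary conditions admits a unit cell carrying all four labels. -/
theorem exists_rainbow_cell (p : ℕ) (L : ℕ → ℕ → ℕ → Fin 4)
    (hc0 : ∀ a b, L a b 0 ≠ 0) (hc1 : ∀ a b, L a b p ≠ 1)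
    (hb0 : ∀ a c, L a 0 c ≠ 0 ∧ L a 0 c ≠ 1) (hb1 : ∀ a c, L a p c ≠ 2)
    (ha0 : ∀ b c, L 0 b c = 3) (ha1 : ∀ b c, L p b c ≠ 3) :
    ∃ a < p, ∃ b < p, ∃ c < p, ∀ i, ∃ x y z : ℕ, x ≤ 1 ∧ y ≤ 1 ∧ z ≤ 1 ∧
      L (a + x) (b + y) (c + z) = i := by
  classical
  let T : Fin 4 → Fin 4 → Fin 4 → Fin 4 → ZMod 2 := fun w x y z =>
    if ∀ i, i = w ∨ i = x ∨ i = y ∨ i = z then 1 else 0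
  let t : Fin 4 → Fin 4 → Fin 4 → ZMod 2 := fun x y z =>
    if ∀ i, i = 3 ∨ i = x ∨ i = y ∨ i = z then 1 else 0
  let e : Fin 4 → Fin 4 → ZMod 2 := fun x y =>
    if (x = 0 ∧ y = 1) ∨ (x = 1 ∧ y = 0) then 1 else 0
  let v : Fin 4 → ZMod 2 := fun x => if x = 0 then 1 else 0
  have hT : ∀ w x y z, T w x y z = t x y z + t w y z + t w x z + t w x y := by decide
  have ht : ∀ x y z, x ≠ 3 → y ≠ 3 → z ≠ 3 → t x y z = e y z + e x z + e x y := by decide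
  have he : ∀ x y, x ≠ 3 → y ≠ 3 → x ≠ 2 → y ≠ 2 → e x y = v y - v x := by decide
  have t0 : ∀ x y z, x ≠ 0 → y ≠ 0 → z ≠ 0 → t x y z = 0 := by decide
  have t1 : ∀ x y z, x ≠ 1 → y ≠ 1 → z ≠ 1 → t x y z = 0 := by decide
  have t2 : ∀ x y z, x ≠ 2 → y ≠ 2 → z ≠ 2 → t x y z = 0 := by decide
  have e0 : ∀ x y, x ≠ 0 → y ≠ 0 → e x y = 0 := by decide
  have e1 : ∀ x y, x ≠ 1 → y ≠ 1 → e x y = 0 := by decide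
  have dbl : ∀ x : ZMod 2, x + x = 0 := by decide
  let S : ℕ → ℕ → ℕ → ZMod 2 := fun a b c =>
    T (L a b c) (L (a+1) b c) (L (a+1) (b+1) c) (L (a+1) (b+1) (c+1)) +
    T (L a b c) (L (a+1) b c) (L (a+1) b (c+1)) (L (a+1) (b+1) (c+1)) +
    T (L a b c) (L a (b+1) c) (L (a+1) (b+1) c) (L (a+1) (b+1) (c+1)) +
    T (L a b c) (L a (b+1) c) (L a (b+1) (c+1)) (L (a+1) (b+1) (c+1)) +
    T (L a b c) (L a b (c+1)) (L (a+1) b (c+1)) (L (a+1) (b+1) (c+1)) +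
    T (L a b c) (L a b (c+1)) (L a (b+1) (c+1)) (L (a+1) (b+1) (c+1))
  let A : ℕ → ℕ → ℕ → ZMod 2 := fun a b c =>
    t (L a b c) (L a (b+1) c) (L a (b+1) (c+1)) + t (L a b c) (L a b (c+1)) (L a (b+1) (c+1))
  let B : ℕ → ℕ → ℕ → ZMod 2 := fun b a c =>
    t (L a b c) (L (a+1) b c) (L (a+1) b (c+1)) + t (L a b c) (L a b (c+1)) (L (a+1) b (c+1))
  let C : ℕ → ℕ → ℕ → ZMod 2 := fun c a b =>
    t (L a b c) (L (a+1) b c) (L (a+1) (b+1) c) + t (L a b c) (L a (b+1) c) (L (a+1) (b+1) c)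
  have hS : ∀ a b c, S a b c =
      (A (a+1) b c - A a b c) + (B (b+1) a c - B b a c) + (C (c+1) a b - C c a b) := by
    intro a b c
    simp only [S, A, B, C, hT, CharTwo.sub_eq_add]
    linear_combination
      dbl (t (L a b c) (L (a+1) b c) (L (a+1) (b+1) (c+1))) +
      dbl (t (L a b c) (L a (b+1) c) (L (a+1) (b+1) (c+1))) +
      dbl (t (L a b c) (L a b (c+1)) (L (a+1) (b+1) (c+1))) +
      dbl (t (L a b c) (L (a+1) (b+1) c) (L (a+1) (b+1) (c+1))) +
      dbl (t (L a b c) (L (a+1) b (c+1)) (L (a+1) (b+1) (c+1))) +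
      dbl (t (L a b c) (L a (b+1) (c+1)) (L (a+1) (b+1) (c+1)))
  have hsum : ∑ a ∈ Finset.range p, ∑ b ∈ Finset.range p, ∑ c ∈ Finset.range p, S a b c = 1 := by
    have hA : ∑ a ∈ Finset.range p, ∑ b ∈ Finset.range p, ∑ c ∈ Finset.range p,
        (A (a+1) b c - A a b c) = 1 := by
      have htel : ∀ b, ∑ a ∈ Finset.range p, ∑ c ∈ Finset.range p, (A (a+1) b c - A a b c) =
          ∑ c ∈ Finset.range p, (A p b c - A 0 b c) := fun b => by
        rw [Finset.sum_comm]
        exact Finset.sum_congr rfl fun c _ => Finset.sum_range_sub (fun a => A a b c) p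
      rw [Finset.sum_comm]
      simp only [htel]
      have hA0 : ∀ b c, A 0 b c = 0 := fun b c => by
        simp only [A, ha0]; decide
      let P : ℕ → ℕ → ZMod 2 := fun b c => e (L p b c) (L p b (c+1))
      let Q : ℕ → ℕ → ZMod 2 := fun c b => e (L p b c) (L p (b+1) c)
      have hAp : ∀ b c, A p b c = (P (b+1) c - P b c) + (Q (c+1) b - Q c b) := by
        intro b c
        simp only [A, P, Q, ht _ _ _ (ha1 _ _) (ha1 _ _) (ha1 _ _), CharTwo.sub_eq_add]
        linear_combination dbl (e (L p b c) (L p (b+1) (c+1)))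
      simp only [hA0, sub_zero, hAp, Finset.sum_add_distrib]
      rw [Finset.sum_comm]
      have htP : ∀ c, ∑ b ∈ Finset.range p, (P (b+1) c - P b c) = P p c - P 0 c :=
        fun c => Finset.sum_range_sub (fun b => P b c) p
      have htQ : ∀ b, ∑ c ∈ Finset.range p, (Q (c+1) b - Q c b) = Q p b - Q 0 b :=
        fun b => Finset.sum_range_sub (fun c => Q c b) p
      simp only [htP, htQ]
      have hP0 : ∀ c, P 0 c = 0 := fun c => e0 _ _ (hb0 _ _).1 (hb0 _ _).1
      have hQ0 : ∀ b, Q 0 b = 0 := fun b => e0 _ _ (hc0 _ _) (hc0 _ _)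
      have hQp : ∀ b, Q p b = 0 := fun b => e1 _ _ (hc1 _ _) (hc1 _ _)
      have hPp : ∀ c, P p c = v (L p p (c+1)) - v (L p p c) := fun c =>
        he _ _ (ha1 _ _) (ha1 _ _) (hb1 _ _) (hb1 _ _)
      simp only [hP0, hQ0, hQp, hPp, sub_zero, Finset.sum_const_zero, add_zero]
      rw [Finset.sum_range_sub (fun c => v (L p p c))]
      have : L p p p = 0 := by
        have h1 := ha1 p p; have h2 := hb1 p p; have h3 := hc1 p p
        revert h1 h2 h3; generalize L p p p = x; revert x; decide
      simp [v, this, hc0]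
    have hB : ∑ a ∈ Finset.range p, ∑ b ∈ Finset.range p, ∑ c ∈ Finset.range p,
        (B (b+1) a c - B b a c) = 0 := by
      refine Finset.sum_eq_zero fun a _ => ?_
      rw [Finset.sum_comm]
      refine Finset.sum_eq_zero fun c _ => ?_
      rw [Finset.sum_range_sub (fun b => B b a c)]
      simp [B, t0 _ _ _ (hb0 _ _).1 (hb0 _ _).1 (hb0 _ _).1,
        t2 _ _ _ (hb1 _ _) (hb1 _ _) (hb1 _ _)]
    have hC : ∑ a ∈ Finset.range p, ∑ b ∈ Finset.range p, ∑ c ∈ Finset.range p,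
        (C (c+1) a b - C c a b) = 0 := by
      refine Finset.sum_eq_zero fun a _ => Finset.sum_eq_zero fun b _ => ?_
      rw [Finset.sum_range_sub (fun c => C c a b)]
      simp [C, t0 _ _ _ (hc0 _ _) (hc0 _ _) (hc0 _ _),
        t1 _ _ _ (hc1 _ _) (hc1 _ _) (hc1 _ _)]
    simp only [hS, Finset.sum_add_distrib, hA, hB, hC, add_zero]
  by_contra hcon
  refine zero_ne_one (α := ZMod 2) (Eq.trans ?_ hsum)
  refine (Finset.sum_eq_zero fun a ha => Finset.sum_eq_zero fun b hb =>
    Finset.sum_eq_zero fun c hc => ?_).symm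
  rw [Finset.mem_range] at ha hb hc
  have key : ∃ i, ∀ x y z : ℕ, x ≤ 1 → y ≤ 1 → z ≤ 1 → L (a + x) (b + y) (c + z) ≠ i := by
    by_contra! h
    refine hcon ⟨a, ha, b, hb, c, hc, fun i => ?_⟩
    obtain ⟨x, y, z, hx, hy, hz, h⟩ := h i
    exact ⟨x, y, z, hx, hy, hz, h⟩
  obtain ⟨i, hi⟩ := key
  have hT0 : ∀ w x y z, w ≠ i → x ≠ i → y ≠ i → z ≠ i → T w x y z = 0 := by
    intro w x y z hw hx hy hz
    refine if_neg fun h => ?_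
    rcases h i with h | h | h | h <;> simp_all
  have h000 : L a b c ≠ i := hi 0 0 0 (by simp) (by simp) (by simp)
  have h001 : L a b (c+1) ≠ i := hi 0 0 1 (by simp) (by simp) (by simp)
  have h010 : L a (b+1) c ≠ i := hi 0 1 0 (by simp) (by simp) (by simp)
  have h011 : L a (b+1) (c+1) ≠ i := hi 0 1 1 (by simp) (by simp) (by simp)
  have h100 : L (a+1) b c ≠ i := hi 1 0 0 (by simp) (by simp) (by simp)
  have h101 : L (a+1) b (c+1) ≠ i := hi 1 0 1 (by simp) (by simp) (by simp)
  have h110 : L (a+1) (b+1) c ≠ i := hi 1 1 0 (by simp) (by simp) (by simp)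
  have h111 : L (a+1) (b+1) (c+1) ≠ i := hi 1 1 1 (by simp) (by simp) (by simp)
  simp only [S]
  rw [hT0, hT0, hT0, hT0, hT0, hT0] <;> first | assumption | simp

/-- **Rado's theorem** on independent transversals. -/
theorem Matroid.exists_indep_transversal {α ι : Type*} [Finite ι] (M : Matroid α)
    (S : ι → Finset α) (h : ∀ I : Finset ι, (I.card : ℕ∞) ≤ M.eRk (⋃ i ∈ I, (S i : Set α))) :
    ∃ f : ι → α, (∀ i, f i ∈ S i) ∧ f.Injective ∧ M.Indep (Set.range f) := by
  classical
  have := Fintype.ofFinite ι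
  induction hn : ∑ i, (S i).card using Nat.strong_induction_on generalizing S with
  | _ n ih =>
  by_cases hone : ∀ i, (S i).card ≤ 1
  · have hne : ∀ i, ∃ x, S i = {x} := fun i => by
      refine Finset.card_eq_one.1 ((hone i).antisymm (Nat.one_le_iff_ne_zero.2 fun h0 => ?_))
      have := h {i}
      simp [Finset.card_eq_zero.1 h0] at this
    choose f hf using hne
    have hU : (⋃ i ∈ (Finset.univ : Finset ι), (S i : Set α)) = Set.range f := by
      ext x; simp [hf, eq_comm]
    have hr := h Finset.univ
    rw [hU, Finset.card_univ] at hr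
    have hfin : (Set.range f).Finite := Set.finite_range f
    have hcard : (Set.range f).encard ≤ Fintype.card ι := by
      rw [← Set.image_univ, ← ENat.card_eq_coe_fintype_card, ← Set.encard_univ]
      exact Set.encard_image_le _ _
    refine ⟨f, fun i => by simp [hf], ?_, ?_⟩
    · have he : (f '' Set.univ).encard = (Set.univ : Set ι).encard := by
        rw [Set.image_univ, Set.encard_univ, ENat.card_eq_coe_fintype_card]
        exact hcard.antisymm (hr.trans (M.eRk_le_encard _))
      exact Set.injOn_univ.1 (Set.finite_univ.injOn_of_encard_image_eq he)
    · obtain ⟨I, hI, hIi, hIc⟩ := Matroid.le_eRk_iff.1 hr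
      rwa [← hfin.eq_of_subset_of_encard_le' hI (hIc ▸ hcard)]
  · push Not at hone
    obtain ⟨i, hi⟩ := hone
    obtain ⟨x, hx, y, hy, hxy⟩ := Finset.one_lt_card.1 hi
    have reduce : ∀ z ∈ S i, (∃ f : ι → α, (∀ i, f i ∈ S i) ∧ f.Injective ∧
        M.Indep (Set.range f)) ∨ ∃ I : Finset ι, i ∉ I ∧
          M.eRk ((⋃ j ∈ I, (S j : Set α)) ∪ (S i \ {z})) ≤ I.card := by
      intro z hz
      by_cases hS : ∀ I : Finset ι, (I.card : ℕ∞) ≤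
          M.eRk (⋃ j ∈ I, (Function.update S i ((S i).erase z) j : Set α))
      · left
        obtain ⟨f, hf, hinj, hind⟩ := ih _ (by
          rw [← hn]
          refine Finset.sum_lt_sum (fun j _ => ?_) ⟨i, Finset.mem_univ _, ?_⟩
          · by_cases hj : j = i
            · subst hj; simp [Finset.card_erase_le]
            · simp [hj]
          · simpa using Finset.card_erase_lt_of_mem hz) _ hS rfl
        refine ⟨f, fun j => ?_, hinj, hind⟩
        have := hf j
        by_cases hj : j = i
        · subst hj; simp at this; exact this.2
        · simpa [hj] using this
      · right
        push Not at hS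
        obtain ⟨I, hI⟩ := hS
        have hiI : i ∈ I := by
          by_contra hiI
          refine (h I).not_gt (lt_of_eq_of_lt ?_ hI)
          congr 1
          refine Set.iUnion₂_congr fun j hj => ?_
          rw [Function.update_of_ne (ne_of_mem_of_not_mem hj hiI)]
        refine ⟨I.erase i, Finset.notMem_erase _ _, ?_⟩
        have hc : (I.card : ℕ∞) = (I.erase i).card + 1 := by
          exact_mod_cast (Finset.card_erase_add_one hiI).symm
        rw [hc] at hI
        refine le_trans (M.eRk_mono ?_) (Order.le_of_lt_add_one hI)
        rintro a (ha | ha)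
        · simp only [Set.mem_iUnion] at ha ⊢
          obtain ⟨j, hj, ha⟩ := ha
          exact ⟨j, Finset.mem_of_mem_erase hj, by
            rwa [Function.update_of_ne (Finset.ne_of_mem_erase hj)]⟩
        · simp only [Set.mem_iUnion]
          exact ⟨i, hiI, by simpa [and_comm] using ha⟩
    rcases reduce x hx with hf | ⟨I, hiI, hI⟩
    · exact hf
    rcases reduce y hy with hf | ⟨J, hiJ, hJ⟩
    · exact hf
    exfalso
    have hsub := M.eRk_submod ((⋃ j ∈ I, (S j : Set α)) ∪ (S i \ {x}))
      ((⋃ j ∈ J, (S j : Set α)) ∪ (S i \ {y}))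
    have h1 : ((I ∩ J).card : ℕ∞) ≤ M.eRk (((⋃ j ∈ I, (S j : Set α)) ∪ (S i \ {x})) ∩
        ((⋃ j ∈ J, (S j : Set α)) ∪ (S i \ {y}))) := by
      refine (h _).trans (M.eRk_mono fun a ha => ?_)
      simp only [Set.mem_iUnion, Finset.mem_inter] at ha
      obtain ⟨j, ⟨hj, hj'⟩, ha⟩ := ha
      exact ⟨Or.inl (Set.mem_biUnion hj ha), Or.inl (Set.mem_biUnion hj' ha)⟩
    have h2 : ((insert i (I ∪ J)).card : ℕ∞) ≤ M.eRk (((⋃ j ∈ I, (S j : Set α)) ∪ (S i \ {x})) ∪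
        ((⋃ j ∈ J, (S j : Set α)) ∪ (S i \ {y}))) := by
      refine (h _).trans (M.eRk_mono fun a ha => ?_)
      simp only [Set.mem_iUnion, Finset.mem_insert, Finset.mem_union] at ha
      obtain ⟨j, rfl | hj | hj, ha⟩ := ha
      · by_cases hax : a = x
        · exact Or.inr (Or.inr ⟨ha, by simpa [hax] using hxy⟩)
        · exact Or.inl (Or.inr ⟨ha, hax⟩)
      · exact Or.inl (Or.inl (Set.mem_biUnion hj ha))
      · exact Or.inr (Or.inl (Set.mem_biUnion hj ha))
    rw [Finset.card_insert_of_notMem (by simp [hiI, hiJ])] at h2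
    have h3 := (add_le_add h1 h2).trans (hsub.trans (add_le_add hI hJ))
    have h4 := Finset.card_union_add_card_inter I J
    have h5 : (I ∩ J).card + ((I ∪ J).card + 1) ≤ I.card + J.card := by exact_mod_cast h3
    omega

/-- The boundary conditions of a labelling of the unit cube that is pulled back from a Sperner
labelling of a tetrahedron along `(a, b, c) ↦ (abc, ab(1 - c), a(1 - b), 1 - a)`. -/
structure IsCubeLabelling (P : Fin 4 → ℝ × ℝ × ℝ → Prop) : Prop where
  left_zero : ∀ b c i, P i (0, b, c) → i = 3
  left_one : ∀ b c, ¬ P 3 (1, b, c)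
  mid_zero : ∀ a c, ¬ P 0 (a, 0, c) ∧ ¬ P 1 (a, 0, c)
  mid_one : ∀ a c, ¬ P 2 (a, 1, c)
  right_zero : ∀ a b, ¬ P 0 (a, b, 0)
  right_one : ∀ a b, ¬ P 1 (a, b, 1)

theorem IsCubeLabelling.mono {P Q : Fin 4 → ℝ × ℝ × ℝ → Prop} (hP : IsCubeLabelling P)
    (h : ∀ i x, Q i x → P i x) : IsCubeLabelling Q where
  left_zero b c i hi := hP.left_zero b c i (h _ _ hi)
  left_one b c hi := hP.left_one b c (h _ _ hi)
  mid_zero a c := ⟨fun hi => (hP.mid_zero a c).1 (h _ _ hi),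
    fun hi => (hP.mid_zero a c).2 (h _ _ hi)⟩
  mid_one a c hi := hP.mid_one a c (h _ _ hi)
  right_zero a b hi := hP.right_zero a b (h _ _ hi)
  right_one a b hi := hP.right_one a b (h _ _ hi)

/-- A Knaster–Kuratowski–Mazurkiewicz theorem for the unit cube. -/
theorem exists_mem_all_of_isCubeLabelling (A : Fin 4 → Set (ℝ × ℝ × ℝ))
    (hA : ∀ i, IsClosed (A i)) (hcov : ∀ x ∈ Set.Icc (0 : ℝ × ℝ × ℝ) 1, ∃ i, x ∈ A i)
    (hlab : IsCubeLabelling fun i x => x ∈ Set.Icc (0 : ℝ × ℝ × ℝ) 1 ∧ x ∈ A i) :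
    ∃ x ∈ Set.Icc (0 : ℝ × ℝ × ℝ) 1, ∀ i, x ∈ A i := by
  by_contra! hcon
  obtain ⟨δ, hδ, hball⟩ := lebesgue_number_lemma_of_metric (c := fun i => (A i)ᶜ)
    (isCompact_Icc (a := (0 : ℝ × ℝ × ℝ)) (b := 1)) (fun i => (hA i).isOpen_compl)
    (fun x hx => Set.mem_iUnion.2 (hcon x hx))
  obtain ⟨n, hn⟩ := exists_nat_one_div_lt hδ
  set p := n + 1 with hp
  have hp0 : (0 : ℝ) < p := by positivity
  let r : ℕ → ℝ := fun k => ((min k p : ℕ) : ℝ) / p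
  have hr0 : r 0 = 0 := by simp [r]
  have hrp : r p = 1 := by simp [r, hp0.ne']
  have hr : ∀ k, 0 ≤ r k ∧ r k ≤ 1 := fun k =>
    ⟨by positivity, (div_le_one hp0).2 (by exact_mod_cast min_le_right _ _)⟩
  have hmem : ∀ a b c, (r a, r b, r c) ∈ Set.Icc (0 : ℝ × ℝ × ℝ) 1 := fun a b c =>
    ⟨⟨(hr a).1, (hr b).1, (hr c).1⟩, ⟨(hr a).2, (hr b).2, (hr c).2⟩⟩
  have hstep : ∀ k x, k < p → x ≤ 1 → dist (r (k + x)) (r k) < δ := by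
    intro k x hk hx
    refine lt_of_le_of_lt ?_ hn
    have hd : r (k + x) - r k = x / p := by
      simp only [r]
      rw [min_eq_left (by omega : k + x ≤ p), min_eq_left hk.le]
      push_cast; ring
    have hx' : (x : ℝ) ≤ 1 := by exact_mod_cast hx
    rw [Real.dist_eq, hd, abs_of_nonneg (by positivity)]
    have : (p : ℝ) = n + 1 := by simp [hp]
    rw [← this]
    gcongr
  choose! label hlabel using hcov
  have hL : ∀ a b c i, label (r a, r b, r c) = i →
      (r a, r b, r c) ∈ Set.Icc (0 : ℝ × ℝ × ℝ) 1 ∧ (r a, r b, r c) ∈ A i := fun a b c i h =>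
    ⟨hmem a b c, h ▸ hlabel _ (hmem a b c)⟩
  obtain ⟨a, ha, b, hb, c, hc, hcell⟩ := exists_rainbow_cell p
    (fun a b c => label (r a, r b, r c))
    (fun a b h => hlab.right_zero (r a) (r b) (by simpa only [hr0] using hL a b 0 _ h))
    (fun a b h => hlab.right_one (r a) (r b) (by simpa only [hrp] using hL a b p _ h))
    (fun a c => ⟨fun h => (hlab.mid_zero (r a) (r c)).1 (by simpa only [hr0] using hL a 0 c _ h),
      fun h => (hlab.mid_zero (r a) (r c)).2 (by simpa only [hr0] using hL a 0 c _ h)⟩)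
    (fun a c h => hlab.mid_one (r a) (r c) (by simpa only [hrp] using hL a p c _ h))
    (fun b c => hlab.left_zero (r b) (r c) _ (by simpa only [hr0] using hL 0 b c _ rfl))
    (fun b c h => hlab.left_one (r b) (r c) (by simpa only [hrp] using hL p b c _ h))
  obtain ⟨i, hi⟩ := hball _ (hmem a b c)
  obtain ⟨x, y, z, hx, hy, hz, h⟩ := hcell i
  have hin : (r (a + x), r (b + y), r (c + z)) ∈ Metric.ball (r a, r b, r c) δ := by
    simp only [Metric.mem_ball, Prod.dist_eq, max_lt_iff]
    exact ⟨hstep a x ha hx, hstep b y hb hy, hstep c z hc hz⟩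
  exact hi hin (hL _ _ _ _ h).2

/-- A matroidal version of the colourful KKM theorem: if the elements of `F` receive labels that
depend on a point `x` of the cube, and the labelled elements always contain four independent ones,
then at some point there are four independent elements carrying the four different labels. -/
theorem Matroid.exists_indep_labelled {α : Type*} (M : Matroid α) (F : Finset α)
    (w : α → Fin 4 → ℝ × ℝ × ℝ → ℝ) (hw : ∀ K i, Continuous (w K i))
    (hw0 : ∀ K i x, 0 ≤ w K i x)
    (hlab : IsCubeLabelling fun i x => x ∈ Set.Icc (0 : ℝ × ℝ × ℝ) 1 ∧ ∃ K ∈ F, 0 < w K i x)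
    (hbase : ∀ x ∈ Set.Icc (0 : ℝ × ℝ × ℝ) 1, ∃ B ⊆ F, M.Indep (B : Set α) ∧ B.card = 4 ∧
      ∀ K ∈ B, ∃ i, 0 < w K i x) :
    ∃ x ∈ Set.Icc (0 : ℝ × ℝ × ℝ) 1, ∃ f : Fin 4 → α, f.Injective ∧ (∀ i, f i ∈ F) ∧
      M.Indep (Set.range f) ∧ ∀ i, 0 < w (f i) i x := by
  classical
  let W : α → ℝ × ℝ × ℝ → ℝ := fun K x => ∑ i, w K i x
  let 𝓑 : Finset (Finset α) := {B ∈ F.powerset | M.Indep (B : Set α) ∧ B.card = 4}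
  let D : ℝ × ℝ × ℝ → ℝ := fun x => ∑ B ∈ 𝓑, ∏ K ∈ B, W K x
  let H : Fin 4 → ℝ × ℝ × ℝ → ℝ := fun i x =>
    ∑ B ∈ 𝓑, ∑ K ∈ B, w K i x * ∏ K' ∈ B.erase K, W K' x
  have hW0 : ∀ K x, 0 ≤ W K x := fun K x => Finset.sum_nonneg fun i _ => hw0 K i x
  have hWc : ∀ K, Continuous (W K) := fun K => continuous_finsetSum _ fun i _ => hw K i
  have hDc : Continuous D :=
    continuous_finsetSum _ fun B _ => continuous_finsetProd _ fun K _ => hWc K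
  have hHc : ∀ i, Continuous (H i) := fun i =>
    continuous_finsetSum _ fun B _ => continuous_finsetSum _ fun K _ =>
      (hw K i).mul (continuous_finsetProd _ fun K' _ => hWc K')
  have hDpos : ∀ x ∈ Set.Icc (0 : ℝ × ℝ × ℝ) 1, 0 < D x := by
    intro x hx
    obtain ⟨B, hBF, hBi, hB4, hB⟩ := hbase x hx
    refine Finset.sum_pos' (fun B _ => Finset.prod_nonneg fun K _ => hW0 K x)
      ⟨B, by simp [𝓑, hBF, hBi, hB4], Finset.prod_pos fun K hK => ?_⟩
    obtain ⟨i, hi⟩ := hB K hK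
    exact Finset.sum_pos' (fun i _ => hw0 K i x) ⟨i, Finset.mem_univ _, hi⟩
  have hHsum : ∀ x, ∑ i, H i x = 4 * D x := by
    intro x
    simp only [H, D]
    rw [Finset.sum_comm, Finset.mul_sum]
    refine Finset.sum_congr rfl fun B hB => ?_
    rw [Finset.sum_comm]
    have hB4 : B.card = 4 := (Finset.mem_filter.1 hB).2.2
    have : ∀ K ∈ B, ∑ i, w K i x * ∏ K' ∈ B.erase K, W K' x = ∏ K ∈ B, W K x := fun K hK => by
      rw [← Finset.sum_mul]
      exact Finset.mul_prod_erase B (fun K => W K x) hK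
    rw [Finset.sum_congr rfl this]
    simp [hB4]
  obtain ⟨x, hx, hxA⟩ := exists_mem_all_of_isCubeLabelling (fun i => {x | D x ≤ H i x})
    (fun i => isClosed_le hDc (hHc i))
    (fun x _ => by
      by_contra! h
      have := Finset.sum_lt_sum_of_nonempty (s := (Finset.univ : Finset (Fin 4)))
        (f := fun i => H i x) (g := fun _ => D x) Finset.univ_nonempty
        fun i _ => not_le.1 fun hi => h i hi
      rw [hHsum] at this
      simp at this)
    (hlab.mono fun i x ⟨hx, hxi⟩ => by
      refine ⟨hx, ?_⟩
      by_contra! h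
      have hH0 : H i x = 0 := Finset.sum_eq_zero fun B hB => Finset.sum_eq_zero fun K hK => by
        rw [(h K (Finset.mem_powerset.1 (Finset.mem_filter.1 hB).1 hK)).antisymm (hw0 K i x),
          zero_mul]
      have : D x ≤ H i x := hxi
      linarith [hDpos x hx])
  have hD := hDpos x hx
  let S : Fin 4 → Finset α := fun i => {K ∈ F | 0 < w K i x}
  obtain ⟨f, hf, hinj, hind⟩ := M.exists_indep_transversal S (fun I => by
    obtain ⟨B, hB, hIB⟩ : ∃ B ∈ 𝓑, I.card ≤ {K ∈ B | ∃ i ∈ I, K ∈ S i}.card := by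
      by_contra! hlt
      have h1 : ∑ i ∈ I, D x ≤ ∑ i ∈ I, H i x := Finset.sum_le_sum fun i _ => hxA i
      have h2 : ∑ i ∈ I, H i x ≤ ∑ B ∈ 𝓑, ((I.card : ℝ) - 1) * ∏ K ∈ B, W K x := by
        simp only [H]
        rw [Finset.sum_comm]
        refine Finset.sum_le_sum fun B hB => ?_
        rw [Finset.sum_comm]
        have hprod : 0 ≤ ∏ K ∈ B, W K x := Finset.prod_nonneg fun K _ => hW0 K x
        have hle : ∀ K ∈ B, ∑ i ∈ I, w K i x * ∏ K' ∈ B.erase K, W K' x ≤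
            if ∃ i ∈ I, K ∈ S i then ∏ K ∈ B, W K x else 0 := by
          intro K hK
          split_ifs with h
          · rw [← Finset.sum_mul, ← Finset.mul_prod_erase B (fun K => W K x) hK]
            refine mul_le_mul_of_nonneg_right ?_ (Finset.prod_nonneg fun K _ => hW0 K x)
            exact Finset.sum_le_univ_sum_of_nonneg fun i => hw0 K i x
          · push Not at h
            refine (Finset.sum_eq_zero fun i hi => ?_).le
            have hKF := Finset.mem_powerset.1 (Finset.mem_filter.1 hB).1 hK
            have := h i hi
            simp only [S, Finset.mem_filter, hKF, true_and, not_lt] at this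
            rw [this.antisymm (hw0 K i x), zero_mul]
        refine (Finset.sum_le_sum hle).trans ?_
        rw [← Finset.sum_filter, Finset.sum_const, nsmul_eq_mul]
        refine mul_le_mul_of_nonneg_right ?_ hprod
        have : ({K ∈ B | ∃ i ∈ I, K ∈ S i}.card : ℝ) + 1 ≤ I.card := by exact_mod_cast hlt B hB
        linarith
      rw [← Finset.mul_sum, Finset.sum_const, nsmul_eq_mul] at *
      change _ ≤ _ * D x at h2
      nlinarith
    have hBi : M.Indep ({K ∈ B | ∃ i ∈ I, K ∈ S i} : Finset α) :=
      (Finset.mem_filter.1 hB).2.1.subset (Finset.coe_subset.2 (Finset.filter_subset _ _))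
    refine le_trans (by exact_mod_cast hIB) ((Set.encard_coe_eq_coe_finsetCard _).symm.le.trans
      (hBi.encard_le_eRk_of_subset fun K hK => ?_))
    obtain ⟨-, i, hi, hK⟩ := Finset.mem_filter.1 (Finset.mem_coe.1 hK)
    exact Set.mem_biUnion hi hK)
  exact ⟨x, hx, f, hinj, fun i => (Finset.mem_filter.1 (hf i)).1, hind,
    fun i => (Finset.mem_filter.1 (hf i)).2⟩

theorem mrank_coe_of_indep {α : Type*} {M : Matroid α} {B : Finset α} (hB : M.Indep (B : Set α)) :
    mrank M (B : Set α) = B.card := by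
  refine IsGreatest.csSup_eq ⟨⟨B, subset_rfl, hB, Set.ncard_coe_finset B⟩, ?_⟩
  rintro n ⟨I, hI, -, rfl⟩
  exact (Set.ncard_le_ncard hI B.finite_toSet).trans (Set.ncard_coe_finset B).le

theorem exists_indep_card_eq_of_lt_mrank {α : Type*} {M : Matroid α} {A : Set α} (hA : A.Finite)
    {n : ℕ} (h : n < mrank M A) :
    ∃ B : Finset α, (B : Set α) ⊆ A ∧ M.Indep (B : Set α) ∧ B.card = n + 1 := by
  obtain ⟨m, ⟨I, hIA, hI, rfl⟩, hm⟩ := exists_lt_of_lt_csSup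
    (s := {n : ℕ | ∃ I ⊆ A, M.Indep I ∧ I.ncard = n})
    ⟨0, ∅, Set.empty_subset _, M.empty_indep, Set.ncard_empty _⟩ h
  lift I to Finset α using hA.subset hIA
  rw [Set.ncard_coe_finset] at hm
  obtain ⟨B, hBI, hB⟩ := Finset.exists_subset_card_eq (Nat.succ_le_of_lt hm)
  exact ⟨B, (Finset.coe_subset.2 hBI).trans hIA, hI.subset (Finset.coe_subset.2 hBI), hB⟩

/-- The affine function vanishing on the chord through the points of angles `2 * s` and `2 * t` of
the circle of radius `R` about the origin (on the tangent line, if these points coincide). -/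
noncomputable def chord (R s t : ℝ) (q : EuclideanSpace ℝ (Fin 2)) : ℝ :=
  R * Real.cos (s - t) - q 0 * Real.cos (s + t) - q 1 * Real.sin (s + t)

theorem isLine_chord (R s t : ℝ) : IsLine {q | chord R s t q = 0} := by
  set C := Real.cos (s + t)
  set D := Real.sin (s + t)
  have hCD : C ^ 2 + D ^ 2 = 1 := Real.cos_sq_add_sin_sq _
  set e := R * Real.cos (s - t)
  set v : EuclideanSpace ℝ (Fin 2) := !₂[-D, C] with hv
  have hv0 : v ≠ 0 := fun h => by
    have h0 := congrFun (congrArg WithLp.ofLp h) 0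
    have h1 := congrFun (congrArg WithLp.ofLp h) 1
    simp [hv] at h0 h1
    simp [h0, h1] at hCD
  refine ⟨AffineSubspace.mk' !₂[e * C, e * D] (Submodule.span ℝ {v}), ?_, ?_⟩
  · rw [AffineSubspace.direction_mk', finrank_span_singleton hv0]
  · ext q
    rw [SetLike.mem_coe, AffineSubspace.mem_mk', Submodule.mem_span_singleton]
    change e - q 0 * C - q 1 * D = 0 ↔ _
    constructor
    · intro h
      refine ⟨-(q 0 * D) + q 1 * C, ?_⟩
      ext i
      fin_cases i
      · simp [hv]
        linear_combination C * h + q 0 * hCD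
      · simp [hv]
        linear_combination D * h + q 1 * hCD
    · rintro ⟨k, hk⟩
      have h0 := congrFun (congrArg WithLp.ofLp hk) 0
      have h1 := congrFun (congrArg WithLp.ofLp hk) 1
      simp [hv] at h0 h1
      linear_combination C * h0 + D * h1 - e * hCD

theorem chord_comm (R s t : ℝ) (q) : chord R s t q = chord R t s q := by
  rw [chord, chord, add_comm t s, ← Real.cos_neg (s - t), neg_sub]

theorem chord_add_pi (R s t : ℝ) (q) : chord R s (t + Real.pi) q = -chord R s t q := by
  rw [chord, chord, ← add_assoc, sub_add_eq_sub_sub, Real.cos_sub_pi, Real.cos_add_pi,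
    Real.sin_add_pi]
  ring

theorem chord_self_pos {R : ℝ} (s : ℝ) {q : EuclideanSpace ℝ (Fin 2)} (hR : ‖q‖ < R) :
    0 < chord R s s q := by
  have hsq : q 0 ^ 2 + q 1 ^ 2 < R ^ 2 := by
    have := EuclideanSpace.real_norm_sq_eq q
    rw [Fin.sum_univ_two] at this
    rw [← this]
    gcongr
  have h := Real.cos_sq_add_sin_sq (s + s)
  have hR0 : 0 < R := (norm_nonneg q).trans_lt hR
  have hlt : q 0 * Real.cos (s + s) + q 1 * Real.sin (s + s) < R := by
    refine lt_of_pow_lt_pow_left₀ 2 hR0.le ?_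
    nlinarith [sq_nonneg (q 0 * Real.sin (s + s) - q 1 * Real.cos (s + s))]
  rw [chord, sub_self, Real.cos_zero]
  linarith

theorem chord_interpolate (R a b c s : ℝ) (q) :
    Real.sin (c - a) * chord R s b q =
      Real.sin (c - b) * chord R s a q + Real.sin (b - a) * chord R s c q := by
  simp only [chord, Real.sin_sub, Real.cos_sub, Real.cos_add, Real.sin_add]
  ring

theorem chord_nonpos_of_neg {R a b c : ℝ} {q : EuclideanSpace ℝ (Fin 2)} (hR : ‖q‖ < R)
    (hab : a ≤ b) (hbc : b ≤ c) (hca : c ≤ a + Real.pi) (h : chord R a b q < 0) :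
    chord R a c q ≤ 0 := by
  by_contra! hc
  have hpos := chord_self_pos a hR
  rcases hca.eq_or_lt with rfl | hca
  · rw [chord_add_pi] at hc
    linarith
  have hac : a < c := by
    refine (hab.trans hbc).lt_of_ne ?_
    rintro rfl
    rw [hbc.antisymm hab] at h
    linarith
  have h1 := Real.sin_pos_of_pos_of_lt_pi (x := c - a) (by linarith) (by linarith)
  have h2 := Real.sin_nonneg_of_nonneg_of_le_pi (x := c - b) (by linarith) (by linarith)
  have h3 := Real.sin_nonneg_of_nonneg_of_le_pi (x := b - a) (by linarith) (by linarith)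
  nlinarith [chord_interpolate R a b c a q, mul_pos_of_neg_of_neg (neg_lt_zero.2 h1) h,
    mul_nonneg h2 hpos.le, mul_nonneg h3 hc.le]

theorem chord_nonpos_of_neg' {R a b c : ℝ} {q : EuclideanSpace ℝ (Fin 2)} (hR : ‖q‖ < R)
    (hab : a ≤ b) (hbc : b ≤ c) (hca : c ≤ a + Real.pi) (h : chord R c b q < 0) :
    chord R c a q ≤ 0 := by
  have key : ∀ s, chord R c s q = -chord R (c - Real.pi) s q := fun s => by
    rw [chord_comm R c, chord_comm R _ s, ← chord_add_pi, sub_add_cancel]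
  by_contra! hc
  rw [key] at h hc
  have := chord_nonpos_of_neg hR (a := c - Real.pi) (b := a) (c := b) (by linarith) hab
    (by linarith) (by linarith)
  linarith

/-- The function whose positivity region is the `i`-th of the four regions cut out by the chord of
half-angles `s, u` and the chord of half-angles `0, t`. -/
noncomputable def regionMargin (R s t u : ℝ) (i : Fin 4) (q : EuclideanSpace ℝ (Fin 2)) : ℝ :=
  min ((![1, -1, -1, 1] : Fin 4 → ℝ) i * chord R s u q)
    ((![-1, -1, 1, 1] : Fin 4 → ℝ) i * chord R 0 t q)

section Regions

variable {R s t u : ℝ} {q : EuclideanSpace ℝ (Fin 2)}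

theorem regionMargin_zero_nonpos (hR : ‖q‖ < R) (hs : s = 0) (ht : 0 ≤ t) (htu : t ≤ u)
    (hu : u ≤ Real.pi) : regionMargin R s t u 0 q ≤ 0 := by
  subst hs
  by_contra! h
  simp [regionMargin] at h
  linarith [chord_nonpos_of_neg hR ht htu (by linarith) h.2]

theorem regionMargin_one_nonpos (hR : ‖q‖ < R) (hs : 0 ≤ s) (hst : s = t) (htu : t ≤ u)
    (hu : u ≤ Real.pi) : regionMargin R s t u 1 q ≤ 0 := by
  subst hst
  by_contra! h
  simp [regionMargin] at h
  have := chord_nonpos_of_neg hR htu hu (by linarith) h.1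
  rw [← zero_add Real.pi, chord_add_pi, chord_comm] at this
  linarith

theorem regionMargin_two_nonpos (hR : ‖q‖ < R) (hs : 0 ≤ s) (hst : s ≤ t) (htu : t = u)
    (hu : u ≤ Real.pi) : regionMargin R s t u 2 q ≤ 0 := by
  subst htu
  by_contra! h
  simp [regionMargin] at h
  rw [chord_comm, chord_comm R 0] at h
  linarith [chord_nonpos_of_neg' hR hs hst (by linarith) h.1]

theorem regionMargin_three_nonpos (hR : ‖q‖ < R) (hs : 0 ≤ s) (hst : s ≤ t) (htu : t ≤ u)
    (hu : u = Real.pi) : regionMargin R s t u 3 q ≤ 0 := by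
  subst hu
  by_contra! h
  simp [regionMargin] at h
  rw [← zero_add Real.pi, chord_add_pi, chord_comm] at h
  linarith [chord_nonpos_of_neg hR hs hst (by linarith) (by linarith [h.1])]

end Regions

/-- A line misses one of the four regions cut out by two lines. -/
theorem IsLine.not_forall_regionMargin_pos {l : Set (EuclideanSpace ℝ (Fin 2))} (hl : IsLine l)
    {R s t u : ℝ} {q : Fin 4 → EuclideanSpace ℝ (Fin 2)} (hq : ∀ i, q i ∈ l) :
    ¬ ∀ i, 0 < regionMargin R s t u i (q i) := by
  intro h
  obtain ⟨L, hL, rfl⟩ := hl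
  obtain ⟨⟨v, hv⟩, -, hspan⟩ := finrank_eq_one_iff'.1 hL
  have hparam : ∀ i, ∃ k : ℝ, q i = q 0 + k • v := fun i => by
    obtain ⟨k, hk⟩ := hspan ⟨_, AffineSubspace.vsub_mem_direction (hq i) (hq 0)⟩
    refine ⟨k, ?_⟩
    have := congrArg Subtype.val hk
    simp only [SetLike.mk_smul_mk] at this
    rw [this]; simp
  choose k hk using hparam
  have haff : ∀ a b, ∃ m n : ℝ, ∀ i, chord R a b (q i) = m * k i + n := fun a b =>
    ⟨-(v 0 * Real.cos (a + b) + v 1 * Real.sin (a + b)), chord R a b (q 0), fun i => by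
      rw [hk i]; simp [chord]; ring⟩
  obtain ⟨m, n, hmn⟩ := haff s u
  obtain ⟨m', n', hmn'⟩ := haff 0 t
  have h0 := h 0
  have h1 := h 1
  have h2 := h 2
  have h3 := h 3
  simp only [regionMargin, hmn, hmn'] at h0 h1 h2 h3
  simp at h0 h1 h2 h3
  generalize k 0 = k0 at *
  generalize k 1 = k1 at *
  generalize k 2 = k2 at *
  generalize k 3 = k3 at *
  have e1 : 0 < m * (k0 - k2) := by linarith
  have e2 : 0 < m * (k3 - k1) := by linarith
  have e3 : 0 < m' * (k2 - k0) := by linarith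
  have e4 : 0 < m' * (k3 - k1) := by linarith
  have p1 := mul_pos e1 e4
  have p2 := mul_pos e2 e3
  nlinarith

theorem IsPreconnected.pos_or_neg {X : Type*} [TopologicalSpace X] {K : Set X}
    (hK : IsPreconnected K) {f : X → ℝ} (hf : Continuous f) (h0 : ∀ x ∈ K, f x ≠ 0) :
    (∀ x ∈ K, 0 < f x) ∨ ∀ x ∈ K, f x < 0 := by
  by_contra! h
  obtain ⟨⟨x, hx, hfx⟩, y, hy, hfy⟩ := h
  obtain ⟨z, hz, hfz⟩ := hK.intermediate_value hx hy hf.continuousOn ⟨hfx, hfy⟩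
  exact h0 z hz hfz

theorem IsCompact.sInf_image_max_zero_pos_iff {X : Type*} [TopologicalSpace X] {K : Set X}
    (hK : IsCompact K) {g : X → ℝ} (hg : Continuous g) :
    0 < sInf ((fun x => max 0 (g x)) '' K) ↔ K.Nonempty ∧ ∀ x ∈ K, 0 < g x := by
  refine ⟨fun h => ⟨?_, fun x hx => ?_⟩, fun ⟨hne, h⟩ => ?_⟩
  · rw [Set.nonempty_iff_ne_empty]
    rintro rfl
    simp at h
  · have hle : sInf ((fun x => max 0 (g x)) '' K) ≤ max 0 (g x) :=
      csInf_le ⟨0, by rintro _ ⟨x, -, rfl⟩; exact le_max_left _ _⟩ ⟨x, hx, rfl⟩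
    exact (lt_max_iff.1 (h.trans_le hle)).resolve_left (lt_irrefl 0)
  · obtain ⟨x, hx, he⟩ := hK.exists_sInf_image_eq hne (continuous_const.max hg).continuousOn
    rw [he]
    exact lt_max_of_lt_right (h x hx)

/-- The regions of the two chords attached to a point of the cube satisfy the boundary
conditions of a cube labelling. -/
theorem isCubeLabelling_regionMargin {R : ℝ} : IsCubeLabelling fun i x =>
    x ∈ Set.Icc (0 : ℝ × ℝ × ℝ) 1 ∧ ∃ q : EuclideanSpace ℝ (Fin 2), ‖q‖ < R ∧
      0 < regionMargin R (Real.pi * x.1 * x.2.1 * x.2.2) (Real.pi * x.1 * x.2.1)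
        (Real.pi * x.1) i q := by
  have hord : ∀ a b c : ℝ, (a, b, c) ∈ Set.Icc (0 : ℝ × ℝ × ℝ) 1 →
      0 ≤ Real.pi * a * b * c ∧ Real.pi * a * b * c ≤ Real.pi * a * b ∧
        Real.pi * a * b ≤ Real.pi * a ∧ Real.pi * a ≤ Real.pi := by
    rintro a b c ⟨⟨ha, hb, hc⟩, ha1, hb1, hc1⟩
    simp only [Prod.fst_zero, Prod.snd_zero, Prod.fst_one, Prod.snd_one] at *
    have h1 := mul_nonneg Real.pi_pos.le ha
    have h2 := mul_nonneg h1 hb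
    exact ⟨mul_nonneg h2 hc, mul_le_of_le_one_right h2 hc1, mul_le_of_le_one_right h1 hb1,
      mul_le_of_le_one_right Real.pi_pos.le ha1⟩
  refine ⟨?_, ?_, ?_, ?_, ?_, ?_⟩
  · rintro b c i ⟨hx, q, hq, hpos⟩
    obtain ⟨h0, h1, h2, h3⟩ := hord _ _ _ hx
    by_contra hi
    refine hpos.not_ge ?_
    fin_cases i
    · exact regionMargin_zero_nonpos hq (by simp) (h0.trans h1) h2 h3
    · exact regionMargin_one_nonpos hq h0 (by simp) h2 h3
    · exact regionMargin_two_nonpos hq h0 h1 (by simp) h3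
    · exact absurd rfl hi
  · rintro b c ⟨hx, q, hq, hpos⟩
    obtain ⟨h0, h1, h2, h3⟩ := hord _ _ _ hx
    exact hpos.not_ge (regionMargin_three_nonpos hq h0 h1 h2 (by simp))
  · refine fun a c => ⟨?_, ?_⟩ <;> rintro ⟨hx, q, hq, hpos⟩ <;>
      obtain ⟨h0, h1, h2, h3⟩ := hord _ _ _ hx
    · exact hpos.not_ge (regionMargin_zero_nonpos hq (by simp) (h0.trans h1) h2 h3)
    · exact hpos.not_ge (regionMargin_one_nonpos hq h0 (by simp) h2 h3)
  · rintro a c ⟨hx, q, hq, hpos⟩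
    obtain ⟨h0, h1, h2, h3⟩ := hord _ _ _ hx
    exact hpos.not_ge (regionMargin_two_nonpos hq h0 h1 (by simp) h3)
  · rintro a b ⟨hx, q, hq, hpos⟩
    obtain ⟨h0, h1, h2, h3⟩ := hord _ _ _ hx
    exact hpos.not_ge (regionMargin_zero_nonpos hq (by simp) (h0.trans h1) h2 h3)
  · rintro a b ⟨hx, q, hq, hpos⟩
    obtain ⟨h0, h1, h2, h3⟩ := hord _ _ _ hx
    exact hpos.not_ge (regionMargin_one_nonpos hq h0 (by simp) h2 h3)

theorem continuous_chord (R s t : ℝ) : Continuous (chord R s t) := by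
  unfold chord
  fun_prop

theorem exists_regionMargin_pos {R s t u : ℝ} {K : Set (EuclideanSpace ℝ (Fin 2))}
    (hK : Convex ℝ K) (h₁ : ∀ q ∈ K, chord R s u q ≠ 0) (h₂ : ∀ q ∈ K, chord R 0 t q ≠ 0) :
    ∃ i, ∀ q ∈ K, 0 < regionMargin R s t u i q := by
  rcases hK.isPreconnected.pos_or_neg (continuous_chord R s u) h₁ with h₁ | h₁ <;>
    rcases hK.isPreconnected.pos_or_neg (continuous_chord R 0 t) h₂ with h₂ | h₂
  · exact ⟨3, fun q hq => by simp [regionMargin, h₁ q hq, h₂ q hq]⟩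
  · exact ⟨0, fun q hq => by simp [regionMargin, h₁ q hq, h₂ q hq]⟩
  · exact ⟨2, fun q hq => by simp [regionMargin, h₁ q hq, h₂ q hq]⟩
  · exact ⟨1, fun q hq => by simp [regionMargin, h₁ q hq, h₂ q hq]⟩

/-- **Matroid coloring version of Eckhoff's `T(4)` theorem.** Let `F` be a finite
family of compact convex sets in `ℝ²` and `M` a matroid with ground set `F` and
rank 4.  If every 4 sets of `F` of rank 4 can be pierced by a line, then there are
2 lines piercing a subfamily `F' ⊆ F` with `r(F ∖ F') ≤ 3`. -/
theorem matroid_T4 (F : Finset (Set (EuclideanSpace ℝ (Fin 2))))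
    (hcompact : ∀ s ∈ F, IsCompact s) (hconvex : ∀ s ∈ F, Convex ℝ s)
    (M : Matroid (Set (EuclideanSpace ℝ (Fin 2)))) (hE : M.E = ↑F)
    (hrk : mrank M ↑F = 4)
    (hT4 : ∀ G ⊆ F, G.card = 4 → mrank M ↑G = 4 →
      ∃ l, IsLine l ∧ ∀ s ∈ G, (l ∩ s).Nonempty) :
    ∃ F' ⊆ F, mrank M ((F : Set (Set (EuclideanSpace ℝ (Fin 2)))) \ ↑F') ≤ 3 ∧
      ∃ l₁ l₂, IsLine l₁ ∧ IsLine l₂ ∧ ∀ s ∈ F', ((l₁ ∪ l₂) ∩ s).Nonempty := by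
  classical
  obtain ⟨R, hR⟩ : ∃ R : ℝ, ∀ K ∈ F, ∀ q ∈ K, ‖q‖ < R := by
    have hb : Bornology.IsBounded (⋃ K ∈ F, K) :=
      (Bornology.isBounded_biUnion_finset F).2 fun K hK => (hcompact K hK).isBounded
    obtain ⟨R, hR⟩ := hb.exists_norm_le
    exact ⟨R + 1, fun K hK q hq => (hR q (Set.mem_biUnion hK hq)).trans_lt (lt_add_one R)⟩
  let margin : Fin 4 → ℝ × ℝ × ℝ → EuclideanSpace ℝ (Fin 2) → ℝ := fun i x q =>
    regionMargin R (Real.pi * x.1 * x.2.1 * x.2.2) (Real.pi * x.1 * x.2.1) (Real.pi * x.1) i q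
  have hmargin : ∀ i, Continuous fun p : (ℝ × ℝ × ℝ) × EuclideanSpace ℝ (Fin 2) =>
      margin i p.1 p.2 := by
    intro i
    simp only [margin, regionMargin, chord]
    fun_prop
  let w : Set (EuclideanSpace ℝ (Fin 2)) → Fin 4 → ℝ × ℝ × ℝ → ℝ := fun K i x =>
    if K ∈ F then sInf ((fun q => max 0 (margin i x q)) '' K) else 0
  have hwc : ∀ K i, Continuous (w K i) := by
    intro K i
    by_cases hK : K ∈ F
    · simp only [w, hK, if_true]
      exact (hcompact K hK).continuous_sInf (f := fun x q => max 0 (margin i x q))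
        (continuous_const.max (hmargin i))
    · simp only [w, hK, if_false]
      exact continuous_const
  have hw0 : ∀ K i x, 0 ≤ w K i x := by
    intro K i x
    simp only [w]
    split_ifs
    · refine Real.sInf_nonneg ?_
      rintro _ ⟨q, -, rfl⟩
      exact le_max_left _ _
    · exact le_rfl
  have hwpos : ∀ K ∈ F, ∀ i x, 0 < w K i x ↔ K.Nonempty ∧ ∀ q ∈ K, 0 < margin i x q := by
    intro K hK i x
    simp only [w, hK, if_true]
    exact (hcompact K hK).sInf_image_max_zero_pos_iff
      ((hmargin i).comp (f := fun q => (x, q)) (by fun_prop))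
  by_contra! hcon
  obtain ⟨x, -, f, hinj, hfF, hind, hf⟩ := M.exists_indep_labelled F w hwc hw0
    (isCubeLabelling_regionMargin.mono fun i x ⟨hx, K, hK, h⟩ => by
      obtain ⟨⟨q, hq⟩, h⟩ := (hwpos K hK i x).1 h
      exact ⟨hx, q, hR K hK q hq, h q hq⟩)
    (fun x _ => by
      let l₁ := {q | chord R (Real.pi * x.1 * x.2.1 * x.2.2) (Real.pi * x.1) q = 0}
      let l₂ := {q | chord R 0 (Real.pi * x.1 * x.2.1) q = 0}
      have hlt : 3 < mrank M ((F : Set (Set (EuclideanSpace ℝ (Fin 2)))) \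
          ↑{K ∈ F | ((l₁ ∪ l₂) ∩ K).Nonempty}) := by
        by_contra! hle
        obtain ⟨K, hK, hne⟩ := hcon _ (Finset.filter_subset _ _) hle l₁ l₂ (isLine_chord _ _ _)
          (isLine_chord _ _ _)
        exact (Finset.mem_filter.1 hK).2.ne_empty hne
      obtain ⟨B, hBF, hB, hB4⟩ := exists_indep_card_eq_of_lt_mrank
        (F.finite_toSet.subset Set.sdiff_subset) hlt
      have hBF' : B ⊆ F := Finset.coe_subset.1 (hBF.trans Set.sdiff_subset)
      obtain ⟨l, -, hl⟩ := hT4 B hBF' hB4 ((mrank_coe_of_indep hB).trans hB4)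
      refine ⟨B, hBF', hB, hB4, fun K hK => ?_⟩
      have hmiss : ∀ q ∈ K, q ∉ l₁ ∪ l₂ := fun q hq hql =>
        (hBF hK).2 (Finset.mem_coe.2 (Finset.mem_filter.2 ⟨hBF' hK, q, hql, hq⟩))
      obtain ⟨i, hi⟩ := exists_regionMargin_pos (hconvex K (hBF' hK))
        (fun q hq h => hmiss q hq (Or.inl h)) (fun q hq h => hmiss q hq (Or.inr h))
      exact ⟨i, (hwpos K (hBF' hK) i x).2 ⟨(hl K hK).mono Set.inter_subset_right, hi⟩⟩)
  have hG : ((Finset.univ.image f : Finset _) : Set (Set (EuclideanSpace ℝ (Fin 2)))) =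
      Set.range f := by simp
  have hG4 : (Finset.univ.image f).card = 4 := by
    rw [Finset.card_image_of_injective _ hinj, Finset.card_univ, Fintype.card_fin]
  obtain ⟨l, hl, hlf⟩ := hT4 (Finset.univ.image f)
    (fun K hK => by
      obtain ⟨i, -, rfl⟩ := Finset.mem_image.1 hK
      exact hfF i) hG4
    ((mrank_coe_of_indep (hG ▸ hind)).trans hG4)
  choose q hql hqf using fun i => hlf (f i) (Finset.mem_image_of_mem f (Finset.mem_univ i))
  exact hl.not_forall_regionMargin_pos hql fun i =>
    ((hwpos _ (hfF i) i x).1 (hf i)).2 (q i) (hqf i)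
end
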